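/- Let n ≥ 2 be an integer. There exist C > 0 and a positive integer k (depending only on n) such that for every finite field K of characteristic ≠ 2 and for every set A ⊆ SL_n(K) generating SL_n(K), we have |cl((A_k)')| ≥ C·|A|^{1/(n+1)}, where (A_k)' is the set of semisimple elements of A_k. -/

import Mathlib

open Pointwise

/-- `A_r = (A ∪ A⁻¹ ∪ {1})^r`. -/
def prodSet {G : Type*} [Group G] (A : Set G) (r : ℕ) : Set G :=
  (A ∪ A⁻¹ ∪ {1}) ^ r

/-- An element of `SL_n(K)` is semisimple if it is diagonalizable over the algebraic
closure `K̄`. -/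
def IsSemisimpleElt (n : ℕ) (K : Type*) [Field K]
    (g : Matrix.SpecialLinearGroup (Fin n) K) : Prop :=
  ∃ (P : (Matrix (Fin n) (Fin n) (AlgebraicClosure K))ˣ)
    (d : Matrix (Fin n) (Fin n) (AlgebraicClosure K)), d.IsDiag ∧
      (g : Matrix (Fin n) (Fin n) K).map (algebraMap K (AlgebraicClosure K)) =
        (P : Matrix (Fin n) (Fin n) (AlgebraicClosure K)) * d *
          ((P⁻¹ : (Matrix (Fin n) (Fin n) (AlgebraicClosure K))ˣ) :
            Matrix (Fin n) (Fin n) (AlgebraicClosure K))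

section Escape

variable {G : Type*} [Group G] {K : Type*} [Field K]

theorem one_mem_prodSet (A : Set G) (r : ℕ) : (1 : G) ∈ prodSet A r :=
  Set.one_mem_pow (by simp)

theorem prodSet_mono (A : Set G) {r s : ℕ} (h : r ≤ s) : prodSet A r ⊆ prodSet A s :=
  Set.pow_subset_pow_right (by simp) h

theorem prodSet_add (A : Set G) (r s : ℕ) :
    prodSet A (r + s) = prodSet A r * prodSet A s := pow_add (A ∪ A⁻¹ ∪ {1}) r s

theorem prodSet_inv (A : Set G) (r : ℕ) : (prodSet A r)⁻¹ = prodSet A r := by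
  have hS : (A ∪ A⁻¹ ∪ {1})⁻¹ = A ∪ A⁻¹ ∪ {1} := by
    simp [Set.union_inv, Set.union_comm]
  refine (inv_pow (A ∪ A⁻¹ ∪ {1}) r).symm.trans ?_
  rw [hS]
  rfl

theorem mul_mem_prodSet {A : Set G} {r s : ℕ} {x y : G} (hx : x ∈ prodSet A r)
    (hy : y ∈ prodSet A s) : x * y ∈ prodSet A (r + s) := by
  rw [prodSet_add]
  exact Set.mul_mem_mul hx hy

theorem mem_prodSet_one {A : Set G} {x : G} (hx : x ∈ A) : x ∈ prodSet A 1 := by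
  have h : prodSet A 1 = A ∪ A⁻¹ ∪ {1} := pow_one (A ∪ A⁻¹ ∪ {1})
  simp [h, hx]

theorem exists_mem_prodSet {A : Set G} (hA : Subgroup.closure A = ⊤) (x : G) :
    ∃ r, x ∈ prodSet A r := by
  have hx : x ∈ Subgroup.closure A := hA ▸ Subgroup.mem_top x
  induction hx using Subgroup.closure_induction with
  | mem x hx => exact ⟨1, mem_prodSet_one hx⟩
  | one => exact ⟨0, one_mem_prodSet A 0⟩
  | mul x y _ _ h₁ h₂ =>
    obtain ⟨r, hr⟩ := h₁
    obtain ⟨s, hs⟩ := h₂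
    exact ⟨r + s, mul_mem_prodSet hr hs⟩
  | inv x _ h =>
    obtain ⟨r, hr⟩ := h
    refine ⟨r, ?_⟩
    rw [← prodSet_inv]
    exact Set.inv_mem_inv.2 hr

/-- The functions in `V` vanishing on `prodSet A k`. -/
def vanishingOn (V : Submodule K (G → K)) (A : Set G) (k : ℕ) : Submodule K V where
  carrier := {f | ∀ x ∈ prodSet A k, f.1 x = 0}
  add_mem' := fun {f g} hf hg x hx => by simp [hf x hx, hg x hx]
  zero_mem' := fun x _ => rfl
  smul_mem' := fun c f hf x hx => by simp [hf x hx]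

theorem vanishingOn_antitone (V : Submodule K (G → K)) (A : Set G) :
    Antitone (vanishingOn V A) := fun _ _ h _ hf x hx => hf x (prodSet_mono A h hx)

theorem vanishingOn_succ {V : Submodule K (G → K)} (hV : ∀ f ∈ V, ∀ g : G, (fun x => f (g * x)) ∈ V)
    {A : Set G} {k : ℕ} (h : vanishingOn V A k = vanishingOn V A (k + 1)) :
    vanishingOn V A (k + 1) = vanishingOn V A (k + 2) := by
  refine le_antisymm (fun f hf x hx => ?_) (vanishingOn_antitone V A (by omega))
  rw [show k + 2 = 1 + (k + 1) by omega, prodSet_add] at hx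
  obtain ⟨s, hs, y, hy, rfl⟩ := Set.mem_mul.1 hx
  have : (⟨fun x => f.1 (s * x), hV f.1 f.2 s⟩ : V) ∈ vanishingOn V A k := by
    intro z hz
    refine hf (s * z) ?_
    rw [add_comm]
    exact mul_mem_prodSet hs hz
  rw [h] at this
  exact this y hy

/-- Escape from subvarieties: a function from a translation-invariant space `V` of dimension at
most `m` that vanishes on the `m`-fold product set of a generating set vanishes identically. -/
theorem eq_zero_of_forall_mem_prodSet (V : Submodule K (G → K)) [FiniteDimensional K V]
    (hV : ∀ f ∈ V, ∀ g : G, (fun x => f (g * x)) ∈ V) {A : Set G}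
    (hA : Subgroup.closure A = ⊤) {m : ℕ} (hm : Module.finrank K V ≤ m) {f : G → K}
    (hf : f ∈ V) (h0 : ∀ x ∈ prodSet A m, f x = 0) : f = 0 := by
  obtain ⟨k, hk, hk'⟩ : ∃ k ≤ m, vanishingOn V A k = vanishingOn V A (k + 1) := by
    by_contra! hne
    have hlt : ∀ k ≤ m + 1, Module.finrank K (vanishingOn V A k) + k ≤ m := by
      intro k
      induction k with
      | zero => intro _; exact (Submodule.finrank_le _).trans hm
      | succ k ih =>
        intro hk
        have h1 := ih (by omega)
        have h2 := Submodule.finrank_lt_finrank_of_lt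
          (lt_of_le_of_ne (vanishingOn_antitone V A k.le_succ) (hne k (by omega)).symm)
        simp only [Nat.succ_eq_add_one] at h2
        omega
    have := hlt (m + 1) le_rfl
    omega
  have hst : ∀ j, vanishingOn V A (k + j) = vanishingOn V A (k + j + 1) := by
    intro j
    induction j with
    | zero => exact hk'
    | succ j ih => exact vanishingOn_succ hV ih
  have hst' : ∀ j, vanishingOn V A k = vanishingOn V A (k + j) := by
    intro j
    induction j with
    | zero => rfl
    | succ j ih => rw [ih, hst j]; rfl
  have hfk : (⟨f, hf⟩ : V) ∈ vanishingOn V A k := by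
    have h1 : (⟨f, hf⟩ : V) ∈ vanishingOn V A m := h0
    rwa [show m = k + (m - k) by omega, ← hst'] at h1
  funext x
  obtain ⟨r, hr⟩ := exists_mem_prodSet hA x
  rw [hst' r] at hfk
  exact hfk x (prodSet_mono A (by omega) hr)

/-- A subset of `S` of size at most `dim V` on which vanishing of elements of `V` can be tested. -/
theorem exists_finset_vanishing {G : Type*} (V : Submodule K (G → K)) [FiniteDimensional K V]
    (S : Set G) :
    ∃ H : Finset G, (H : Set G) ⊆ S ∧ H.card ≤ Module.finrank K V ∧
      ∀ f ∈ V, (∀ x ∈ H, f x = 0) → ∀ x ∈ S, f x = 0 := by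
  classical
  let ev : G → Module.Dual K V := fun x => (LinearMap.proj x).comp V.subtype
  obtain ⟨b, hb, hspan, hli⟩ := exists_linearIndependent K (ev '' S)
  have hfin : b.Finite := hli.setFinite
  have : Fintype b := hfin.fintype
  have hcard : Fintype.card b ≤ Module.finrank K V := by
    have := hli.fintype_card_le_finrank
    rwa [Subspace.dual_finrank_eq] at this
  choose p hp hp' using fun φ : b => hb φ.2
  refine ⟨Finset.univ.image p, ?_, Finset.card_image_le.trans hcard, ?_⟩
  · intro x hx
    obtain ⟨φ, -, rfl⟩ := Finset.mem_image.1 (Finset.mem_coe.1 hx)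
    exact hp φ
  · intro f hf h x hx
    let N : Submodule K (Module.Dual K V) :=
      LinearMap.ker (Module.Dual.eval K V ⟨f, hf⟩)
    have hN : Submodule.span K b ≤ N := by
      rw [Submodule.span_le]
      intro φ hφ
      have h1 := h (p ⟨φ, hφ⟩) (Finset.mem_image_of_mem _ (Finset.mem_univ _))
      have h2 := hp' ⟨φ, hφ⟩
      change φ ⟨f, hf⟩ = 0
      rw [← show ev (p ⟨φ, hφ⟩) = φ from h2]
      exact h1
    have h3 : ev x ∈ Submodule.span K b := hspan ▸ Submodule.subset_span ⟨x, hx, rfl⟩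
    exact hN h3

end Escape

section PolyFun

open Matrix

theorem Submodule.prod_mem_pow_card {R A ι : Type*} [CommSemiring R] [CommSemiring A] [Algebra R A]
    (M : Submodule R A) (s : Finset ι) (f : ι → A) (h : ∀ i ∈ s, f i ∈ M) :
    ∏ i ∈ s, f i ∈ M ^ s.card := by
  classical
  induction s using Finset.induction_on with
  | empty => simp [Submodule.one_le.1 le_rfl]
  | insert a s ha ih =>
    rw [Finset.prod_insert ha, Finset.card_insert_of_notMem ha, pow_succ']
    exact Submodule.mul_mem_mul (h a (by simp)) (ih fun i hi => h i (by simp [hi]))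

variable (n : ℕ) (K : Type*) [Field K]

/-- The matrix entries, as functions on `SL_n(K)`. -/
def entryFn (p : Fin n × Fin n) : SpecialLinearGroup (Fin n) K → K := fun x => x.1 p.1 p.2

/-- The linear span of the matrix entries. -/
def linFun : Submodule K (SpecialLinearGroup (Fin n) K → K) :=
  Submodule.span K (Set.range (entryFn n K))

/-- The restrictions to `SL_n(K)` of polynomials of degree at most `d` in the matrix entries. -/
def polyFun (d : ℕ) : Submodule K (SpecialLinearGroup (Fin n) K → K) :=
  (1 ⊔ linFun n K) ^ d

variable {n K}

theorem entryFn_mem (p : Fin n × Fin n) : entryFn n K p ∈ polyFun n K 1 := by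
  rw [polyFun, pow_one]
  exact Submodule.mem_sup_right (Submodule.subset_span ⟨p, rfl⟩)

theorem polyFun_mono {d e : ℕ} (h : d ≤ e) : polyFun n K d ≤ polyFun n K e :=
  pow_le_pow_right' le_sup_left h

theorem one_mem_polyFun (d : ℕ) : (1 : SpecialLinearGroup (Fin n) K → K) ∈ polyFun n K d := by
  refine polyFun_mono (Nat.zero_le d) ?_
  rw [polyFun, pow_zero]
  exact Submodule.one_le.1 le_rfl

theorem const_mem_polyFun (d : ℕ) (c : K) :
    (fun _ : SpecialLinearGroup (Fin n) K => c) ∈ polyFun n K d := by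
  convert (polyFun n K d).smul_mem c (one_mem_polyFun d) using 1
  ext; simp

theorem mul_mem_polyFun {d e : ℕ} {f g : SpecialLinearGroup (Fin n) K → K}
    (hf : f ∈ polyFun n K d) (hg : g ∈ polyFun n K e) : f * g ∈ polyFun n K (d + e) := by
  rw [polyFun, pow_add]
  exact Submodule.mul_mem_mul hf hg

theorem pow_mem_polyFun {d : ℕ} {f : SpecialLinearGroup (Fin n) K → K}
    (hf : f ∈ polyFun n K d) (k : ℕ) : f ^ k ∈ polyFun n K (d * k) := by
  rw [polyFun, pow_mul]
  exact Submodule.pow_mem_pow _ hf k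

theorem prod_mem_polyFun {ι : Type*} (s : Finset ι) (f : ι → SpecialLinearGroup (Fin n) K → K)
    (d : ι → ℕ) (h : ∀ i ∈ s, f i ∈ polyFun n K (d i)) :
    ∏ i ∈ s, f i ∈ polyFun n K (∑ i ∈ s, d i) := by
  classical
  induction s using Finset.induction_on with
  | empty => simpa using one_mem_polyFun 0
  | insert a s ha ih =>
    rw [Finset.prod_insert ha, Finset.sum_insert ha]
    exact mul_mem_polyFun (h a (by simp)) (ih fun i hi => h i (by simp [hi]))

theorem map_polyFun_le {d : ℕ}
    (Φ : (SpecialLinearGroup (Fin n) K → K) →ₐ[K] (SpecialLinearGroup (Fin n) K → K))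
    (h : ∀ p, Φ (entryFn n K p) ∈ polyFun n K 1) {f : SpecialLinearGroup (Fin n) K → K}
    (hf : f ∈ polyFun n K d) : Φ f ∈ polyFun n K d := by
  have h1 : Submodule.map Φ.toLinearMap (1 ⊔ linFun n K) ≤ 1 ⊔ linFun n K := by
    rw [Submodule.map_sup, Submodule.map_one]
    refine sup_le le_sup_left ?_
    rw [linFun, Submodule.map_span_le]
    rintro _ ⟨p, rfl⟩
    have := h p
    rwa [polyFun, pow_one] at this
  have h2 : Submodule.map Φ.toLinearMap (polyFun n K d) ≤ polyFun n K d := by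
    rw [polyFun, Submodule.map_pow]
    exact pow_le_pow_left' h1 d
  exact h2 (Submodule.mem_map_of_mem hf)

theorem comp_mul_left_mem_polyFun {d : ℕ} {f : SpecialLinearGroup (Fin n) K → K}
    (hf : f ∈ polyFun n K d) (g : SpecialLinearGroup (Fin n) K) :
    (fun x => f (g * x)) ∈ polyFun n K d := by
  refine map_polyFun_le (AlgHom.pi fun x => Pi.evalAlgHom K _ (g * x)) (fun p => ?_) hf
  have : (AlgHom.pi fun x => Pi.evalAlgHom K (fun _ => K) (g * x)) (entryFn n K p) =
      ∑ j, g.1 p.1 j • entryFn n K (j, p.2) := by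
    ext x
    simp [entryFn, Matrix.mul_apply]
  rw [this]
  exact Submodule.sum_mem _ fun j _ => Submodule.smul_mem _ _ (entryFn_mem _)

theorem comp_mul_right_mem_polyFun {d : ℕ} {f : SpecialLinearGroup (Fin n) K → K}
    (hf : f ∈ polyFun n K d) (g : SpecialLinearGroup (Fin n) K) :
    (fun x => f (x * g)) ∈ polyFun n K d := by
  refine map_polyFun_le (AlgHom.pi fun x => Pi.evalAlgHom K _ (x * g)) (fun p => ?_) hf
  have : (AlgHom.pi fun x => Pi.evalAlgHom K (fun _ => K) (x * g)) (entryFn n K p) =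
      ∑ j, g.1 j p.2 • entryFn n K (p.1, j) := by
    ext x
    simp [entryFn, Matrix.mul_apply, mul_comm]
  rw [this]
  exact Submodule.sum_mem _ fun j _ => Submodule.smul_mem _ _ (entryFn_mem _)

theorem eval_mem_polyFun {ι : Type*} [Fintype ι] {d e : ℕ} (P : MvPolynomial ι K)
    (hP : P.totalDegree ≤ e) (F : ι → SpecialLinearGroup (Fin n) K → K)
    (hF : ∀ i, F i ∈ polyFun n K d) :
    (fun x => MvPolynomial.eval (fun i => F i x) P) ∈ polyFun n K (d * e) := by
  have : (fun x => MvPolynomial.eval (fun i => F i x) P) =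
      ∑ m ∈ P.support, P.coeff m • ∏ i, F i ^ m i := by
    ext x
    simp [MvPolynomial.eval_eq', Finset.sum_apply, Finset.prod_apply]
  rw [this]
  refine Submodule.sum_mem _ fun m hm => Submodule.smul_mem _ _ ?_
  refine polyFun_mono ?_
    (prod_mem_polyFun _ _ (fun i => d * m i) fun i _ => pow_mem_polyFun (hF i) _)
  rw [← Finset.mul_sum]
  refine Nat.mul_le_mul_left d (le_trans ?_ ((MvPolynomial.le_totalDegree hm).trans hP))
  rw [Finsupp.sum_fintype _ _ (fun _ => rfl)]

theorem det_mem_polyFun {ι : Type*} [Fintype ι] [DecidableEq ι] {d : ℕ}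
    (F : ι → ι → SpecialLinearGroup (Fin n) K → K) (hF : ∀ i j, F i j ∈ polyFun n K d) :
    (fun x => (Matrix.of fun i j => F i j x).det) ∈ polyFun n K (d * Fintype.card ι) := by
  have : (fun x => (Matrix.of fun i j => F i j x).det) =
      ∑ σ : Equiv.Perm ι, ((Equiv.Perm.sign σ : ℤ) : K) • ∏ i, F (σ i) i := by
    ext x
    simp [Matrix.det_apply', Finset.sum_apply, Finset.prod_apply]
  rw [this]
  refine Submodule.sum_mem _ fun σ _ => Submodule.smul_mem _ _ ?_
  refine polyFun_mono ?_ (prod_mem_polyFun _ _ (fun _ => d) fun i _ => hF _ _)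
  simp [mul_comm]

theorem charpoly_coeff_mem_polyFun {k : ℕ} (hk : k ≤ n) (g : SpecialLinearGroup (Fin n) K) :
    (fun x => (x.1 * g.1).charpoly.coeff k) ∈ polyFun n K n := by
  have h0 : (fun x : SpecialLinearGroup (Fin n) K => x.1.charpoly.coeff k) ∈ polyFun n K n := by
    have h1 := eval_mem_polyFun (n := n) (e := n) ((charpoly.univ K (Fin n)).coeff k)
      ((charpoly.univ_coeff_isHomogeneous K (Fin n) k (n - k) (by simp; omega)).totalDegree_le.trans
        (by omega)) (entryFn n K) entryFn_mem
    rw [one_mul] at h1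
    convert h1 using 2 with x
    have h2 := charpoly.univ_coeff_eval₂Hom (Fin n) (RingHom.id K) (fun p => x.1 p.1 p.2) k
    exact h2.symm
  exact comp_mul_right_mem_polyFun h0 g

theorem pow_entry_mem_polyFun (k : ℕ) (a b : Fin n) :
    (fun x : SpecialLinearGroup (Fin n) K => (x.1 ^ k) a b) ∈ polyFun n K k := by
  induction k generalizing b with
  | zero => simpa using const_mem_polyFun 0 ((1 : Matrix (Fin n) (Fin n) K) a b)
  | succ k ih =>
    have : (fun x : SpecialLinearGroup (Fin n) K => (x.1 ^ (k + 1)) a b) =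
        ∑ j, (fun x => (x.1 ^ k) a j) * entryFn n K (j, b) := by
      ext x
      simp [pow_succ, Matrix.mul_apply, entryFn, Finset.sum_apply]
    rw [this]
    exact Submodule.sum_mem _ fun j _ => mul_mem_polyFun (ih j) (entryFn_mem _)

theorem polyFun_finrank_le (d : ℕ) :
    FiniteDimensional K (polyFun n K d) ∧
      Module.finrank K (polyFun n K d) ≤ (n * n + 1) ^ d := by
  classical
  let S : Finset (SpecialLinearGroup (Fin n) K → K) := insert 1 (Finset.univ.image (entryFn n K))
  have hS : polyFun n K d = Submodule.span K ((S ^ d : Finset _) : Set _) := by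
    rw [polyFun, linFun, Submodule.one_eq_span, ← Submodule.span_union, Submodule.span_pow,
      Finset.coe_pow]
    congr 2
    simp [S]
  have hcard : S.card ≤ n * n + 1 := by
    refine (Finset.card_insert_le _ _).trans ?_
    have := Finset.card_image_le (s := Finset.univ) (f := entryFn n K)
    simp at this
    omega
  rw [hS]
  refine ⟨FiniteDimensional.span_finset K _, (finrank_span_finset_le_card _).trans ?_⟩
  exact Finset.card_pow_le.trans (Nat.pow_le_pow_left hcard d)

instance (d : ℕ) : FiniteDimensional K (polyFun n K d) := (polyFun_finrank_le d).1

end PolyFun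

section SharpDimension

open Matrix

variable {n : ℕ} {K : Type*} [Field K]

theorem one_le_linFun_pow :
    (1 : Submodule K (SpecialLinearGroup (Fin n) K → K)) ≤ linFun n K ^ n := by
  rw [Submodule.one_le]
  have : (1 : SpecialLinearGroup (Fin n) K → K) =
      ∑ σ : Equiv.Perm (Fin n), ((Equiv.Perm.sign σ : ℤ) : K) • ∏ i, entryFn n K (σ i, i) := by
    ext x
    have := x.2
    rw [Matrix.det_apply'] at this
    simp [Finset.sum_apply, Finset.prod_apply, entryFn, this]
  rw [this]
  refine Submodule.sum_mem _ fun σ _ => Submodule.smul_mem _ _ ?_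
  simpa using Submodule.prod_mem_pow_card (linFun n K) Finset.univ (fun i => entryFn n K (σ i, i))
    fun i _ => Submodule.subset_span ⟨_, rfl⟩

theorem polyFun_le_iSup (hn : 0 < n) (d : ℕ) :
    polyFun n K d ≤ ⨆ r : Fin n, linFun n K ^ (d + r) := by
  induction d with
  | zero =>
    refine le_trans ?_ (le_iSup (fun r : Fin n => linFun n K ^ (0 + (r : ℕ))) ⟨0, hn⟩)
    simp [polyFun]
  | succ d ih =>
    rw [polyFun, pow_succ', ← polyFun]
    refine (mul_le_mul_right ih _).trans ?_
    rw [Submodule.sup_mul, one_mul, Submodule.mul_iSup]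
    refine sup_le (iSup_le fun r => ?_) (iSup_le fun r => ?_)
    · rcases Nat.eq_zero_or_pos (r : ℕ) with h | h
      · refine le_trans ?_ (le_iSup (fun r : Fin n => linFun n K ^ (d + 1 + (r : ℕ)))
          ⟨n - 1, by omega⟩)
        rw [h, add_zero, show d + 1 + (n - 1) = d + n by omega, pow_add]
        conv_lhs => rw [← mul_one (linFun n K ^ d)]
        exact mul_le_mul_right one_le_linFun_pow _
      · refine le_trans ?_ (le_iSup (fun r : Fin n => linFun n K ^ (d + 1 + (r : ℕ)))
          ⟨r - 1, by omega⟩)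
        rw [show d + 1 + ((r : ℕ) - 1) = d + r by omega]
    · rw [← pow_succ']
      refine le_trans ?_ (le_iSup (fun r : Fin n => linFun n K ^ (d + 1 + (r : ℕ))) r)
      rw [show d + 1 + (r : ℕ) = d + r + 1 by omega]

/-- The monomial of degree `m` in the matrix entries with given exponents outside `p₀`. -/
def monoFun (p₀ : Fin n × Fin n) (m : ℕ) (e : {p : Fin n × Fin n // p ≠ p₀} → ℕ) :
    SpecialLinearGroup (Fin n) K → K :=
  (∏ p, entryFn n K p.1 ^ e p) * entryFn n K p₀ ^ (m - ∑ p, e p)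

theorem linFun_pow_le (p₀ : Fin n × Fin n) (m : ℕ) :
    linFun n K ^ m ≤ Submodule.span K {f | ∃ e, ∑ p, e p ≤ m ∧ monoFun p₀ m e = f} := by
  classical
  induction m with
  | zero =>
    rw [pow_zero, Submodule.one_le]
    exact Submodule.subset_span ⟨0, by simp, by simp [monoFun]⟩
  | succ m ih =>
    rw [pow_succ']
    refine (mul_le_mul_right ih _).trans ?_
    rw [linFun, Submodule.span_mul_span, Submodule.span_le]
    rintro _ ⟨_, ⟨p, rfl⟩, _, ⟨e, he, rfl⟩, rfl⟩
    refine Submodule.subset_span ?_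
    by_cases hp : p = p₀
    · refine ⟨e, by omega, ?_⟩
      subst hp
      simp only [monoFun]
      rw [show m + 1 - ∑ q, e q = (m - ∑ q, e q) + 1 by omega, pow_succ']
      ring
    · have hs : ∑ q, (e + Pi.single ⟨p, hp⟩ 1 : {p : Fin n × Fin n // p ≠ p₀} → ℕ) q =
          ∑ q, e q + 1 := by
        simp [Finset.sum_add_distrib]
      refine ⟨e + Pi.single ⟨p, hp⟩ 1, by omega, ?_⟩
      simp only [monoFun]
      rw [hs, show m + 1 - (∑ q, e q + 1) = m - ∑ q, e q by omega, ← mul_assoc]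
      congr 1
      simp only [Pi.add_apply, pow_add, Finset.prod_mul_distrib]
      rw [mul_comm]
      congr 1
      rw [Finset.prod_eq_single ⟨p, hp⟩]
      · simp
      · intro q _ hq
        simp [hq]
      · simp

/-- The space of functions on `SL_n(K)` of degree at most `d` has dimension `O(d^(n²-1))`. -/
theorem polyFun_finrank_le_sharp (hn : 0 < n) (d : ℕ) :
    Module.finrank K (polyFun n K d) ≤ n * (d + n) ^ (n * n - 1) := by
  classical
  let p₀ : Fin n × Fin n := (⟨0, hn⟩, ⟨0, hn⟩)
  let Φ : Fin n × ({p : Fin n × Fin n // p ≠ p₀} → Fin (d + n)) →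
      (SpecialLinearGroup (Fin n) K → K) :=
    fun q => monoFun p₀ (d + q.1) fun p => q.2 p
  have hle : polyFun n K d ≤ Submodule.span K (Set.range Φ) := by
    refine (polyFun_le_iSup hn d).trans (iSup_le fun r => (linFun_pow_le p₀ _).trans ?_)
    refine Submodule.span_mono ?_
    rintro _ ⟨e, he, rfl⟩
    have hlt : ∀ p, e p < d + n := fun p =>
      lt_of_le_of_lt ((Finset.single_le_sum (fun _ _ => Nat.zero_le _)
        (Finset.mem_univ p)).trans he)
        (by omega)
    exact ⟨(r, fun p => ⟨e p, hlt p⟩), rfl⟩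
  have : FiniteDimensional K (Submodule.span K (Set.range Φ)) :=
    FiniteDimensional.span_of_finite K (Set.finite_range Φ)
  refine (Submodule.finrank_mono hle).trans ((finrank_range_le_card Φ).trans ?_)
  simp [Fintype.card_subtype_compl]

end SharpDimension

section Relation

open Matrix

variable {n : ℕ} {K : Type*} [Field K]

/-- A bound for the degrees of the relations between `n² - 1` class functions and an entry. -/
def relDegree (n : ℕ) : ℕ := n * (n * (n * n - 1) + 1 + n) ^ (n * n - 1) + 1

theorem exists_relation (hn : 0 < n) {ι : Type*} [Fintype ι] (hι : Fintype.card ι = n * n - 1)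
    (f : ι → SpecialLinearGroup (Fin n) K → K) (hf : ∀ i, f i ∈ polyFun n K n)
    {y : SpecialLinearGroup (Fin n) K → K} (hy : y ∈ polyFun n K 1) :
    ∃ c : Fin (relDegree n) → MvPolynomial ι K, (∃ β, c β ≠ 0) ∧
      (∀ β, (c β).totalDegree ≤ (n * n - 1) * relDegree n) ∧
      ∀ x, ∑ β, MvPolynomial.eval (fun i => f i x) (c β) * y x ^ (β : ℕ) = 0 := by
  classical
  set D := relDegree n with hD
  have hD1 : 1 ≤ D := by rw [hD, relDegree]; omega
  set N := n * n - 1 with hN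
  let d := (n * N + 1) * D
  let Φ : (ι → Fin D) × Fin D → polyFun n K d := fun q =>
    ⟨(∏ i, f i ^ (q.1 i : ℕ)) * y ^ (q.2 : ℕ), by
      refine polyFun_mono ?_ (mul_mem_polyFun
        (prod_mem_polyFun _ _ (fun i => n * (q.1 i : ℕ)) fun i _ => pow_mem_polyFun (hf i) _)
        (pow_mem_polyFun hy _))
      have h1 : ∑ i, n * (q.1 i : ℕ) ≤ ∑ _i : ι, n * D :=
        Finset.sum_le_sum fun i _ => Nat.mul_le_mul_left n (q.1 i).2.le
      rw [Finset.sum_const, Finset.card_univ, hι, smul_eq_mul] at h1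
      have h2 := (q.2).2.le
      calc _ ≤ N * (n * D) + 1 * D := by gcongr
        _ = d := by simp only [d]; ring⟩
  have hdim : Module.finrank K (polyFun n K d) < Fintype.card ((ι → Fin D) × Fin D) := by
    refine (polyFun_finrank_le_sharp hn d).trans_lt ?_
    rw [Fintype.card_prod, Fintype.card_fun, Fintype.card_fin, hι]
    have h1 : d + n ≤ (n * N + 1 + n) * D := by
      simp only [d]
      nlinarith
    calc n * (d + n) ^ N ≤ n * ((n * N + 1 + n) * D) ^ N := by gcongr
      _ = (n * (n * N + 1 + n) ^ N) * D ^ N := by rw [mul_pow]; ring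
      _ < D * D ^ N := by
        refine Nat.mul_lt_mul_of_pos_right ?_ (by positivity)
        rw [hD, relDegree, ← hN]
        exact Nat.lt_succ_self _
      _ = D ^ N * D := mul_comm _ _
  have hnli : ¬ LinearIndependent K Φ := fun h => absurd h.fintype_card_le_finrank (by omega)
  obtain ⟨g, hg, q₀, hq₀⟩ := Fintype.not_linearIndependent_iff.1 hnli
  let toExp : (ι → Fin D) → (ι →₀ ℕ) := fun α => Finsupp.equivFunOnFinite.symm fun i => (α i : ℕ)
  have hinj : Function.Injective toExp := by
    intro α α' h
    funext i
    exact Fin.ext (DFunLike.congr_fun h i)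
  refine ⟨fun β => ∑ α, MvPolynomial.monomial (toExp α) (g (α, β)), ⟨q₀.2, fun h => hq₀ ?_⟩,
    fun β => ?_, fun x => ?_⟩
  · have := congrArg (MvPolynomial.coeff (toExp q₀.1)) h
    simpa [MvPolynomial.coeff_sum, MvPolynomial.coeff_monomial, hinj.eq_iff] using this
  · refine (MvPolynomial.totalDegree_finsetSum _ _).trans (Finset.sup_le fun α _ => ?_)
    refine (MvPolynomial.totalDegree_monomial_le _ _).trans ?_
    rw [Finsupp.sum_fintype _ _ (fun _ => rfl)]
    have h1 : ∑ i, (toExp α) i ≤ ∑ _i : ι, D := Finset.sum_le_sum fun i _ => (α i).2.le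
    simpa [hι] using h1
  · have h := congrFun (congrArg Subtype.val hg) x
    simp only [AddSubmonoidClass.coe_finsetSum, Finset.sum_apply, Fintype.sum_prod_type_right] at h
    refine Eq.trans (Finset.sum_congr rfl fun β _ => ?_) h
    rw [map_sum, Finset.sum_mul]
    refine Finset.sum_congr rfl fun α _ => ?_
    rw [MvPolynomial.eval_monomial, Finsupp.prod_fintype _ _ (fun _ => pow_zero _)]
    simp [Φ, toExp, Finset.prod_apply, mul_assoc]

end Relation

section Derivative

open Matrix Polynomial

/-- Jacobi's formula for a derivation along a ring homomorphism. -/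
theorem map_det_of_leibniz {S R ι : Type*} [CommRing S] [CommRing R] [Fintype ι] [DecidableEq ι]
    (π : S →+* R) (δ : S →+ R) (h : ∀ a b, δ (a * b) = π a * δ b + δ a * π b)
    (M : Matrix ι ι S) : δ M.det = (adjugate (M.map π) * M.map δ).trace := by
  have h1 : δ 1 = 0 := by simpa using h 1 1
  have hprod : ∀ (s : Finset ι) (f : ι → S),
      δ (∏ i ∈ s, f i) = ∑ j ∈ s, ∏ i ∈ s, if i = j then δ (f i) else π (f i) := by
    intro s f
    induction s using Finset.induction_on with
    | empty => simp [h1]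
    | insert a s ha ih =>
      rw [Finset.prod_insert ha, h, ih, Finset.sum_insert ha, Finset.mul_sum, add_comm]
      congr 1
      · rw [Finset.prod_insert ha, if_pos rfl, map_prod]
        congr 1
        refine Finset.prod_congr rfl fun i hi => ?_
        rw [if_neg (by rintro rfl; exact ha hi)]
      · refine Finset.sum_congr rfl fun j hj => ?_
        rw [Finset.prod_insert ha, if_neg (by rintro rfl; exact ha hj)]
  have hadj : (adjugate (M.map π) * M.map δ).trace =
      ∑ j, ((M.map π).updateRow j (M.map δ j)).det := by
    rw [Matrix.trace_mul_comm]
    simp only [Matrix.trace, Matrix.diag_apply, Matrix.mul_apply]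
    refine Finset.sum_congr rfl fun j _ => ?_
    rw [← Matrix.det_transpose, ← Matrix.updateCol_transpose, ← Matrix.cramer_apply,
      Matrix.cramer_eq_adjugate_mulVec, Matrix.mulVec, dotProduct, ← Matrix.adjugate_transpose]
    exact Finset.sum_congr rfl fun i _ => mul_comm _ _
  rw [hadj, Matrix.det_apply, map_sum]
  simp only [Matrix.det_apply]
  rw [Finset.sum_comm]
  refine Finset.sum_congr rfl fun σ _ => ?_
  rw [← Finset.smul_sum, Units.smul_def, Units.smul_def, map_zsmul, hprod]
  congr 1
  rw [← Equiv.sum_comp σ fun j => ∏ i, (M.map π).updateRow j (M.map δ j) (σ i) i]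
  refine Finset.sum_congr rfl fun j _ => Finset.prod_congr rfl fun i _ => ?_
  rw [Matrix.updateRow_apply]
  by_cases hij : i = j
  · subst hij; simp
  · simp [hij, σ.injective.eq_iff]

theorem coeff_coeff_swap {R : Type*} [CommRing R] (p : R[X][X]) (i j : ℕ) :
    ((Bivariate.swap p).coeff i).coeff j = (p.coeff j).coeff i := by
  induction p using Polynomial.induction_on' with
  | add p q hp hq => simp [hp, hq]
  | monomial n a =>
    induction a using Polynomial.induction_on' with
    | add p q hp hq => simp [map_add, hp, hq]
    | monomial m r =>
      rw [Bivariate.swap_monomial_monomial]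
      simp only [coeff_monomial]
      by_cases h1 : n = j <;> by_cases h2 : m = i <;> simp [h1, h2, coeff_monomial]

variable {ι R : Type*} [Fintype ι] [DecidableEq ι] [CommRing R]

/-- Up to sign, the derivative at `1` of `x ↦ charpoly (x * g)` in the direction `Y`. -/
noncomputable def charDeriv (g Y : Matrix ι ι R) : R[X] :=
  (adjugate (charmatrix g) * (Y * g).map C).trace

theorem coeff_one_charpoly_coeff (x : Matrix ι ι R[X]) (g Y : Matrix ι ι R)
    (h0 : x.map (coeff · 0) = 1) (h1 : x.map (coeff · 1) = Y) (k : ℕ) :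
    ((x * g.map C).charpoly.coeff k).coeff 1 = -(charDeriv g Y).coeff k := by
  have h0' : ∀ i j, (x i j).coeff 0 = (1 : Matrix ι ι R) i j := fun i j =>
    congrFun (congrFun h0 i) j
  have h1' : ∀ i j, (x i j).coeff 1 = Y i j := fun i j => congrFun (congrFun h1 i) j
  let M : Matrix ι ι R[X][X] := (charmatrix (x * g.map C)).map Bivariate.swap
  have hdet : Bivariate.swap (x * g.map C).charpoly = M.det := by
    rw [Matrix.charpoly]
    exact RingHom.map_det (Bivariate.swap (R := R)).toRingEquiv.toRingHom _
  have hδ := map_det_of_leibniz (constantCoeff (R := R[X]))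
    ((lcoeff R[X] 1).toAddMonoidHom) (fun a b => by
      simp [Polynomial.coeff_mul, Finset.Nat.antidiagonal_succ]) M
  have hπ : M.map (constantCoeff (R := R[X])) = charmatrix g := by
    ext i j : 1
    simp only [M, Matrix.map_apply, charmatrix_apply, constantCoeff_apply]
    ext k
    rw [coeff_coeff_swap]
    by_cases hij : i = j
    · subst hij
      rcases k with _ | _ | k <;>
      simp [coeff_X, coeff_C, Matrix.mul_apply, Polynomial.mul_coeff_zero, h0', Matrix.one_apply]
    · rcases k with _ | _ | k <;>
      simp [coeff_C, hij, Matrix.mul_apply, Polynomial.mul_coeff_zero, h0', Matrix.one_apply]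
  have hd : M.map ((lcoeff R[X] 1).toAddMonoidHom) = -(Y * g).map C := by
    ext i j : 1
    simp only [M, Matrix.map_apply, charmatrix_apply, LinearMap.toAddMonoidHom_coe, lcoeff_apply]
    ext k
    rw [coeff_coeff_swap]
    by_cases hij : i = j
    · subst hij
      rcases k with _ | _ | k <;>
      simp [coeff_X, coeff_C, Matrix.mul_apply, h1', Polynomial.coeff_one]
    · rcases k with _ | _ | k <;>
      simp [coeff_C, hij, Matrix.mul_apply, h1']
  rw [← coeff_coeff_swap, hdet]
  have : (M.det).coeff 1 = -charDeriv g Y := by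
    refine Eq.trans hδ ?_
    rw [hπ, hd, charDeriv, Matrix.mul_neg, Matrix.trace_neg]
  rw [this, coeff_neg]

end Derivative

section Curves

open Matrix Polynomial

theorem vecMulVec_single_single {ι K : Type*} [DecidableEq ι] [MulZeroClass K] (a b : ι) (c d : K) :
    vecMulVec (Pi.single a c) (Pi.single b d) = single a b (c * d) := by
  ext i j
  simp only [vecMulVec_apply, single, of_apply, Pi.single_apply, eq_comm (a := a),
    eq_comm (a := b), ite_and]
  split_ifs <;> simp

variable {ι K : Type*} [Fintype ι] [DecidableEq ι] [Field K]

/-- `Y` is the velocity at `1` of a polynomial curve of degree at most `ν` in the special linear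
group. -/
def IsCurveVelocity (ν : ℕ) (Y : Matrix ι ι K) : Prop :=
  ∃ x : Matrix ι ι K[X], x.det = 1 ∧ (∀ i j, (x i j).natDegree ≤ ν) ∧
    x.map (coeff · 0) = 1 ∧ x.map (coeff · 1) = Y

theorem IsCurveVelocity.mono {ν μ : ℕ} {Y : Matrix ι ι K} (h : IsCurveVelocity ν Y) (hν : ν ≤ μ) :
    IsCurveVelocity μ Y := by
  obtain ⟨x, h1, h2, h3⟩ := h
  exact ⟨x, h1, fun i j => (h2 i j).trans hν, h3⟩

theorem IsCurveVelocity.zero : IsCurveVelocity 0 (0 : Matrix ι ι K) := by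
  refine ⟨1, det_one, fun i j => ?_, ?_, ?_⟩
  · rw [one_apply]; split_ifs <;> simp
  · ext i j; by_cases h : i = j <;> simp [one_apply, h]
  · ext i j; by_cases h : i = j <;> simp [one_apply, h, coeff_one]

theorem IsCurveVelocity.add {ν μ : ℕ} {Y Z : Matrix ι ι K} (hY : IsCurveVelocity ν Y)
    (hZ : IsCurveVelocity μ Z) : IsCurveVelocity (ν + μ) (Y + Z) := by
  obtain ⟨x, h1, h2, h3, h4⟩ := hY
  obtain ⟨y, k1, k2, k3, k4⟩ := hZ
  have h3' : ∀ i j, (x i j).coeff 0 = (1 : Matrix ι ι K) i j := fun i j => congrFun₂ h3 i j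
  have h4' : ∀ i j, (x i j).coeff 1 = Y i j := fun i j => congrFun₂ h4 i j
  have k3' : ∀ i j, (y i j).coeff 0 = (1 : Matrix ι ι K) i j := fun i j => congrFun₂ k3 i j
  have k4' : ∀ i j, (y i j).coeff 1 = Z i j := fun i j => congrFun₂ k4 i j
  refine ⟨x * y, by rw [det_mul, h1, k1, one_mul], fun i j => ?_, ?_, ?_⟩
  · rw [mul_apply]
    refine natDegree_sum_le_of_forall_le _ _ fun l _ => ?_
    exact natDegree_mul_le.trans (add_le_add (h2 _ _) (k2 _ _))
  · ext i j
    simp only [map_apply, mul_apply, finsetSum_coeff, mul_coeff_zero, h3', k3']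
    rw [← mul_apply, one_mul]
  · ext i j
    simp only [map_apply, mul_apply, finsetSum_coeff, mul_coeff_one, h3', k3', h4', k4',
      Finset.sum_add_distrib]
    rw [← mul_apply, ← mul_apply, one_mul, mul_one, Matrix.add_apply, add_comm]

theorem IsCurveVelocity.sum {κ : Type*} (s : Finset κ) {ν : ℕ} {Y : κ → Matrix ι ι K}
    (h : ∀ a ∈ s, IsCurveVelocity ν (Y a)) : IsCurveVelocity (s.card * ν) (∑ a ∈ s, Y a) := by
  classical
  induction s using Finset.induction_on with
  | empty => simpa using IsCurveVelocity.zero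
  | insert a s ha ih =>
    rw [Finset.sum_insert ha, Finset.card_insert_of_notMem ha, add_mul, one_mul, add_comm]
    refine ((h a (Finset.mem_insert_self a s)).add
      (ih fun b hb => h b (Finset.mem_insert_of_mem hb))).mono (by omega)

theorem isCurveVelocity_vecMulVec {a b : ι → K} (h : b ⬝ᵥ a = 0) :
    IsCurveVelocity 1 (vecMulVec a b) := by
  have hx : ∀ i j, (1 + replicateCol Unit (fun i => X * C (a i)) *
      replicateRow Unit (fun j => C (b j)) : Matrix ι ι K[X]) i j =
        C ((1 : Matrix ι ι K) i j) + X * C (a i) * C (b j) := by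
    intro i j
    rw [Matrix.add_apply, mul_apply, Fintype.sum_unique, replicateCol_apply, replicateRow_apply,
      one_apply, one_apply, apply_ite C, C_1, C_0]
  refine ⟨1 + replicateCol Unit (fun i => X * C (a i)) * replicateRow Unit (fun j => C (b j)),
    ?_, fun i j => ?_, ?_, ?_⟩
  · rw [det_one_add_replicateCol_mul_replicateRow]
    have : (fun j => C (b j)) ⬝ᵥ (fun i => X * C (a i)) = X * C (b ⬝ᵥ a) := by
      simp only [dotProduct, map_sum, map_mul, Finset.mul_sum]
      exact Finset.sum_congr rfl fun i _ => by ring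
    rw [this, h]; simp
  · rw [hx]
    compute_degree
  · ext i j
    rw [map_apply, hx]
    simp
  · ext i j
    rw [map_apply, hx]
    simp [vecMulVec_apply, coeff_C]

theorem isCurveVelocity_single {a b : ι} (h : a ≠ b) (c : K) :
    IsCurveVelocity 1 (single a b c) := by
  have := isCurveVelocity_vecMulVec (K := K) (a := Pi.single a c) (b := Pi.single b 1)
    (by simp [h])
  rwa [vecMulVec_single_single, mul_one] at this

theorem isCurveVelocity_single_sub_single (a b : ι) (c : K) :
    IsCurveVelocity 3 (single a a c - single b b c) := by
  by_cases h : a = b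
  · subst h; rw [sub_self]; exact IsCurveVelocity.zero.mono (by omega)
  have h1 : IsCurveVelocity 1 (vecMulVec (Pi.single a c - Pi.single b c : ι → K)
      (Pi.single a 1 + Pi.single b 1)) :=
    isCurveVelocity_vecMulVec (by simp [h, Ne.symm h])
  have h2 := (h1.add (isCurveVelocity_single h (-c))).add (isCurveVelocity_single (Ne.symm h) c)
  convert h2 using 1
  rw [sub_vecMulVec, vecMulVec_add, vecMulVec_add]
  simp only [vecMulVec_single_single, mul_one]
  have hs : single a b (-c) = -(single a b c : Matrix ι ι K) :=
    map_neg (singleAddMonoidHom a b) c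
  rw [hs]
  abel

theorem isCurveVelocity_of_trace_eq_zero [Nonempty ι] {Y : Matrix ι ι K} (h : Y.trace = 0) :
    IsCurveVelocity (Fintype.card (ι × ι) * 3) Y := by
  let o : ι := Classical.arbitrary ι
  have key := IsCurveVelocity.sum (K := K) (ι := ι) (Finset.univ : Finset (ι × ι)) (ν := 3)
    (Y := fun p => if p.1 = p.2 then single p.1 p.1 (Y p.1 p.1) - single o o (Y p.1 p.1) else
      single p.1 p.2 (Y p.1 p.2)) (fun p _ => by
        split_ifs with hp
        · exact isCurveVelocity_single_sub_single _ _ _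
        · exact (isCurveVelocity_single hp _).mono (by omega))
  rw [Finset.card_univ] at key
  convert key using 1
  have h1 : ∀ p : ι × ι, (if p.1 = p.2 then single p.1 p.1 (Y p.1 p.1) - single o o (Y p.1 p.1) else
      single p.1 p.2 (Y p.1 p.2)) = single p.1 p.2 (Y p.1 p.2) -
        if p.1 = p.2 then single o o (Y p.1 p.1) else 0 := by
    rintro ⟨a, b⟩
    by_cases hab : a = b
    · subst hab; simp
    · simp [hab]
  rw [Finset.sum_congr rfl fun p _ => h1 p, Finset.sum_sub_distrib, Fintype.sum_prod_type,
    Fintype.sum_prod_type, ← matrix_eq_sum_single Y]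
  simp only [Finset.sum_ite_eq, Finset.mem_univ, if_true]
  have h2 : ∑ a, single o o (Y a a) = (0 : Matrix ι ι K) := by
    have : single o o (∑ a, Y a a) = ∑ a, single o o (Y a a) :=
      map_sum (singleAddMonoidHom o o) _ _
    rw [← this, show ∑ a, Y a a = 0 from h, single_zero]
  rw [h2, sub_zero]

end Curves

section LinearPart

open Matrix Polynomial

variable {ι K : Type*} [Fintype ι] [DecidableEq ι] [Field K]

theorem pow_mem_span_coeff_adjugate [Nonempty ι] (g : Matrix ι ι K) (j : ℕ) :
    g ^ j ∈ Submodule.span K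
      (Set.range (matPolyEquiv (adjugate (charmatrix g))).coeff) := by
  set B := matPolyEquiv (adjugate (charmatrix g)) with hB
  have hmul : (X - C g) * B = g.charpoly.map (algebraMap K (Matrix ι ι K)) := by
    rw [hB, ← matPolyEquiv_charmatrix, ← map_mul, mul_adjugate, matPolyEquiv_smul_one]
    rfl
  have hcoeff : ∀ k, g * B.coeff (k + 1) =
      B.coeff k - g.charpoly.coeff (k + 1) • (1 : Matrix ι ι K) := by
    intro k
    have := congrArg (fun p => p.coeff (k + 1)) hmul
    simp only [sub_mul, coeff_sub, coeff_X_mul, coeff_C_mul, coeff_map,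
      Algebra.algebraMap_eq_smul_one] at this
    rw [← this, sub_sub_cancel]
  have hcoeff0 : g * B.coeff 0 = - (g.charpoly.coeff 0 • (1 : Matrix ι ι K)) := by
    have := congrArg (fun p => p.coeff 0) hmul
    simp only [sub_mul, coeff_sub, mul_coeff_zero, coeff_X_zero, zero_mul, coeff_C_zero, coeff_map,
      Algebra.algebraMap_eq_smul_one, zero_sub] at this
    rw [← this, neg_neg]
  have hB0 : B ≠ 0 := by
    rintro h
    rw [h, mul_zero, eq_comm, Polynomial.map_eq_zero] at hmul
    exact g.charpoly_monic.ne_zero hmul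
  have hmem : ∀ k, B.coeff k ∈ Submodule.span K (Set.range B.coeff) := fun k =>
    Submodule.subset_span ⟨k, rfl⟩
  have h1 : (1 : Matrix ι ι K) ∈ Submodule.span K (Set.range B.coeff) := by
    have h := hcoeff B.natDegree
    rw [coeff_eq_zero_of_natDegree_lt (Nat.lt_succ_self _), mul_zero, eq_comm, sub_eq_zero] at h
    have hc : g.charpoly.coeff (B.natDegree + 1) ≠ 0 := by
      intro hc
      rw [hc, zero_smul] at h
      exact hB0 (leadingCoeff_eq_zero.1 h)
    have := Submodule.smul_mem _ (g.charpoly.coeff (B.natDegree + 1))⁻¹ (hmem B.natDegree)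
    rwa [h, smul_smul, inv_mul_cancel₀ hc, one_smul] at this
  have hstable : ∀ M ∈ Submodule.span K (Set.range B.coeff),
      g * M ∈ Submodule.span K (Set.range B.coeff) := by
    intro M hM
    induction hM using Submodule.span_induction with
    | mem x hx =>
      obtain ⟨k, rfl⟩ := hx
      cases k with
      | zero => rw [hcoeff0]; exact Submodule.neg_mem _ (Submodule.smul_mem _ _ h1)
      | succ k => rw [hcoeff]; exact Submodule.sub_mem _ (hmem k) (Submodule.smul_mem _ _ h1)
    | zero => rw [mul_zero]; exact Submodule.zero_mem _
    | add x y _ _ hx hy => rw [mul_add]; exact Submodule.add_mem _ hx hy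
    | smul c x _ hx => rw [mul_smul_comm]; exact Submodule.smul_mem _ _ hx
  induction j with
  | zero => rwa [pow_zero]
  | succ j ih => rw [pow_succ']; exact hstable _ ih

theorem charDeriv_coeff (g Y : Matrix ι ι K) (k : ℕ) : (charDeriv g Y).coeff k =
    ((matPolyEquiv (adjugate (charmatrix g))).coeff k * (Y * g)).trace := by
  simp only [charDeriv, trace, diag_apply, finsetSum_coeff]
  refine Finset.sum_congr rfl fun i _ => ?_
  rw [Matrix.mul_apply, Matrix.mul_apply, finsetSum_coeff]
  refine Finset.sum_congr rfl fun j _ => ?_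
  rw [map_apply, coeff_mul_C, matPolyEquiv_coeff_apply]

theorem charDeriv_add (g Y Z : Matrix ι ι K) :
    charDeriv g (Y + Z) = charDeriv g Y + charDeriv g Z := by
  ext k; simp [charDeriv_coeff, add_mul, mul_add]

theorem charDeriv_smul (g Y : Matrix ι ι K) (c : K) :
    charDeriv g (c • Y) = c • charDeriv g Y := by
  ext k; simp [charDeriv_coeff]

theorem charDeriv_eq_zero [Nonempty ι] {g Y : Matrix ι ι K} (hg : g.det = 1) (hY : Y.trace = 0)
    (h : ∀ k, 0 < k → k < Fintype.card ι → (charDeriv g Y).coeff k = 0) : charDeriv g Y = 0 := by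
  obtain ⟨x, h1, -, h3, h4⟩ := isCurveVelocity_of_trace_eq_zero hY
  ext k
  rw [coeff_zero]
  by_cases hk : 0 < k ∧ k < Fintype.card ι
  · exact h k hk.1 hk.2
  rw [← neg_eq_zero, ← coeff_one_charpoly_coeff x g Y h3 h4]
  rcases Nat.eq_zero_or_pos k with rfl | h0
  · have hdet := det_eq_sign_charpoly_coeff (x * g.map C)
    have : (g.map C).det = 1 := by
      rw [← RingHom.mapMatrix_apply, ← RingHom.map_det, hg, map_one]
    rw [det_mul, h1, this, one_mul] at hdet
    have h2 : (x * g.map C).charpoly.coeff 0 = (-1) ^ Fintype.card ι := by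
      have h3 := congrArg (((-1 : K[X]) ^ Fintype.card ι) * ·) hdet
      simpa [← mul_assoc, ← mul_pow] using h3.symm
    rw [h2]
    rcases neg_one_pow_eq_or K[X] (Fintype.card ι) with h | h <;> rw [h] <;> simp [coeff_one]
  · have hk : Fintype.card ι ≤ k := not_lt.1 fun hlt => hk ⟨h0, hlt⟩
    rcases hk.eq_or_lt with rfl | hlt
    · have := (x * g.map C).charpoly_monic
      rw [Monic, leadingCoeff, charpoly_natDegree_eq_dim] at this
      rw [this]; simp [coeff_one]
    · rw [coeff_eq_zero_of_natDegree_lt (p := (x * g.map C).charpoly)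
        (by rwa [charpoly_natDegree_eq_dim]), coeff_zero]

theorem trace_pow_mul_eq_zero [Nonempty ι] {g Y : Matrix ι ι K} (h : charDeriv g Y = 0) (j : ℕ) :
    (g ^ (j + 1) * Y).trace = 0 := by
  rw [pow_succ', mul_assoc, trace_mul_comm, mul_assoc]
  generalize hM : g ^ j = M
  have hmem := pow_mem_span_coeff_adjugate g j
  rw [hM] at hmem
  clear hM
  induction hmem using Submodule.span_induction with
  | mem x hx => obtain ⟨k, rfl⟩ := hx; rw [← charDeriv_coeff, h, coeff_zero]
  | zero => simp
  | add x y _ _ hx hy => rw [add_mul, trace_add, hx, hy, add_zero]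
  | smul c x _ hx => rw [smul_mul_assoc, trace_smul, hx, smul_zero]

/-- The powers of the elements of `g` span, together with `1`, the space of all matrices. -/
def PowersSeparate {n m : ℕ} (g : Fin m → SpecialLinearGroup (Fin n) K) : Prop :=
  ∀ Y : Matrix (Fin n) (Fin n) K, Y.trace = 0 →
    (∀ i, ∀ k : Fin (n - 1), ((g i).1 ^ ((k : ℕ) + 1) * Y).trace = 0) → Y = 0

theorem PowersSeparate.exists_charDeriv_coeff {n : ℕ} (hn : 0 < n)
    {g : Fin (n + 1) → SpecialLinearGroup (Fin n) K} (hg : PowersSeparate g)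
    (τ : Fin (n + 1) × Fin (n - 1) → K) : ∃ Y : Matrix (Fin n) (Fin n) K, Y.trace = 0 ∧
      ∀ p, (charDeriv (g p.1).1 Y).coeff ((p.2 : ℕ) + 1) = τ p := by
  have : Nonempty (Fin n) := ⟨⟨0, hn⟩⟩
  let L : Matrix (Fin n) (Fin n) K →ₗ[K] K × (Fin (n + 1) × Fin (n - 1) → K) :=
    { toFun := fun Y => (Y.trace, fun p => (charDeriv (g p.1).1 Y).coeff ((p.2 : ℕ) + 1))
      map_add' := fun Y Z => by ext <;> simp [charDeriv_add]
      map_smul' := fun c Y => by ext <;> simp [charDeriv_smul] }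
  have hinj : Function.Injective L := by
    rw [injective_iff_map_eq_zero]
    intro Y hY
    have h1 : Y.trace = 0 := congrArg Prod.fst hY
    have h2 : ∀ p : Fin (n + 1) × Fin (n - 1),
      (charDeriv (g p.1).1 Y).coeff ((p.2 : ℕ) + 1) = 0 :=
    fun p => congrFun (congrArg Prod.snd hY) p
    refine hg Y h1 fun i k => trace_pow_mul_eq_zero (charDeriv_eq_zero (g i).2 h1 ?_) _
    intro k hk hkn
    rw [Fintype.card_fin] at hkn
    have := h2 (i, ⟨k - 1, by omega⟩)
    rwa [Nat.sub_add_cancel hk] at this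
  have hsurj : Function.Surjective L := by
    refine (LinearMap.injective_iff_surjective_of_finrank_eq_finrank ?_).1 hinj
    rw [Module.finrank_matrix, Module.finrank_prod, Module.finrank_fintype_fun_eq_card]
    simp only [Module.finrank_self, Fintype.card_prod, Fintype.card_fin]
    obtain ⟨m, rfl⟩ : ∃ m, n = m + 1 := ⟨n - 1, by omega⟩
    simp; ring
  obtain ⟨Y, hY⟩ := hsurj (0, τ)
  exact ⟨Y, congrArg Prod.fst hY, fun p => congrFun (congrArg Prod.snd hY) p⟩

end LinearPart

section KeyLemma

open Matrix

theorem MvPolynomial.totalDegree_eval₂_C_comp_le {R S σ τ : Type*} [CommSemiring R] [CommSemiring S]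
    [Fintype σ] (f : R →+* S) {g : σ → MvPolynomial τ S} {e : ℕ}
    (hg : ∀ i, (g i).totalDegree ≤ e) (Q : MvPolynomial σ R) :
    (eval₂ (C.comp f) g Q).totalDegree ≤ Q.totalDegree * e := by
  rw [eval₂_eq']
  refine totalDegree_finsetSum_le fun d hd => (totalDegree_mul _ _).trans ?_
  rw [RingHom.comp_apply, totalDegree_C, zero_add]
  refine (totalDegree_finsetProd _ _).trans ?_
  have h1 : ∑ i, (g i ^ d i).totalDegree ≤ (∑ i, d i) * e := by
    rw [Finset.sum_mul]
    exact Finset.sum_le_sum fun i _ => (totalDegree_pow _ _).trans (Nat.mul_le_mul_left _ (hg i))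
  refine h1.trans (Nat.mul_le_mul_right _ ?_)
  have := le_totalDegree hd
  rwa [Finsupp.sum_fintype _ _ (fun _ => rfl)] at this

theorem MvPolynomial.IsHomogeneous.aeval_mul_left {R S σ : Type*} [CommSemiring R] [CommSemiring S]
    [Algebra R S] [Fintype σ] {Q : MvPolynomial σ R} {d : ℕ} (hQ : Q.IsHomogeneous d) (u : S)
    (F : σ → S) : MvPolynomial.aeval (fun i => u * F i) Q = u ^ d * MvPolynomial.aeval F Q := by
  rw [MvPolynomial.aeval_def, MvPolynomial.aeval_def, MvPolynomial.eval₂_eq',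
    MvPolynomial.eval₂_eq', Finset.mul_sum]
  refine Finset.sum_congr rfl fun e he => ?_
  have hd : ∑ i, e i = d := by
    have := hQ (MvPolynomial.mem_support_iff.1 he)
    simpa [Finsupp.weight_apply, Finsupp.sum_fintype] using this
  simp only [mul_pow, Finset.prod_mul_distrib, Finset.prod_pow_eq_pow_sum, hd]
  ring

open Polynomial in
theorem eval_aeval_mvPolynomial {K σ : Type*} [Field K] (F : σ → K[X]) (Q : MvPolynomial σ K)
    (u : K) : (MvPolynomial.aeval F Q).eval u = MvPolynomial.eval (fun i => (F i).eval u) Q := by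
  rw [← coe_aeval_eq_eval, MvPolynomial.comp_aeval_apply, ← MvPolynomial.coe_aeval_eq_eval]
  rfl

open Polynomial in
theorem coeff_aeval_eq_aeval_of_forall_lt {K σ : Type*} [Field K] [Fintype σ]
    {Q : MvPolynomial σ K} {d : ℕ}
    (hd : ∀ j < d, MvPolynomial.homogeneousComponent j Q = 0) (F : σ → K[X]) :
    (MvPolynomial.aeval (fun i => X * F i) Q).coeff d =
      MvPolynomial.eval (fun i => (F i).coeff 0) (MvPolynomial.homogeneousComponent d Q) := by
  conv_lhs => rw [← MvPolynomial.sum_homogeneousComponent Q, map_sum]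
  rw [finsetSum_coeff]
  have h1 : ∀ j, (MvPolynomial.aeval (fun i => X * F i)
      (MvPolynomial.homogeneousComponent j Q)).coeff d = if j = d then
      MvPolynomial.eval (fun i => (F i).coeff 0) (MvPolynomial.homogeneousComponent d Q)
      else 0 := by
    intro j
    rw [(MvPolynomial.homogeneousComponent_isHomogeneous j Q).aeval_mul_left, coeff_X_pow_mul']
    rcases lt_trichotomy j d with h | rfl | h
    · rw [hd j h, map_zero, coeff_zero, ite_self, if_neg h.ne]
    · rw [if_pos le_rfl, if_pos rfl, Nat.sub_self, coeff_zero_eq_eval_zero,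
        eval_aeval_mvPolynomial]
      simp only [coeff_zero_eq_eval_zero]
    · rw [if_neg (not_le.2 h), if_neg h.ne']
  rw [Finset.sum_congr rfl fun j _ => h1 j, Finset.sum_ite_eq']
  split_ifs with h
  · rfl
  · rw [Finset.mem_range, not_lt] at h
    rw [MvPolynomial.homogeneousComponent_eq_zero _ _ (by omega), map_zero]

open Polynomial in
theorem natDegree_charpoly_coeff_le {ι K : Type*} [Fintype ι] [DecidableEq ι] [Field K]
    {x : Matrix ι ι K[X]} {ν : ℕ} (hx : ∀ i j, (x i j).natDegree ≤ ν) (k : ℕ) :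
    (x.charpoly.coeff k).natDegree ≤ Fintype.card ι * ν := by
  rcases lt_or_ge (Fintype.card ι) k with h | h
  · rw [coeff_eq_zero_of_natDegree_lt (p := x.charpoly) (by rwa [charpoly_natDegree_eq_dim]),
      natDegree_zero]
    exact Nat.zero_le _
  have h1 := charpoly.univ_coeff_eval₂Hom ι (algebraMap K K[X]) (fun p => x p.1 p.2) k
  have h2 : of (Function.curry fun p : ι × ι => x p.1 p.2) = x := rfl
  rw [h2, MvPolynomial.coe_eval₂Hom, ← MvPolynomial.aeval_def] at h1
  rw [← h1]
  refine MvPolynomial.aeval_natDegree_le _ ?_ _ fun p => hx p.1 p.2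
  refine (charpoly.univ_coeff_isHomogeneous K ι k (Fintype.card ι - k)
    (by omega)).totalDegree_le.trans (by omega)

open Polynomial in
theorem PowersSeparate.exists_eval_ne_zero {K : Type*} [Field K] [Fintype K] {n : ℕ} (hn : 0 < n)
    {g : Fin (n + 1) → SpecialLinearGroup (Fin n) K} (hg : PowersSeparate g)
    {Q : MvPolynomial (Fin (n + 1) × Fin (n - 1)) K} (hQ : Q ≠ 0) {E : ℕ} (hE : Q.totalDegree ≤ E)
    (hK : E * (n * (n * n * 3)) < Fintype.card K) :
    ∃ x : SpecialLinearGroup (Fin n) K, MvPolynomial.eval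
      (fun p => (x.1 * (g p.1).1).charpoly.coeff ((p.2 : ℕ) + 1)) Q ≠ 0 := by
  have : Nonempty (Fin n) := ⟨⟨0, hn⟩⟩
  let c : Fin (n + 1) × Fin (n - 1) → K := fun p => (g p.1).1.charpoly.coeff ((p.2 : ℕ) + 1)
  let Q' := MvPolynomial.aeval (fun p => MvPolynomial.X p + MvPolynomial.C (c p)) Q
  have hQ'E : Q'.totalDegree ≤ E := by
    refine (MvPolynomial.totalDegree_eval₂_C_comp_le (RingHom.id K) (e := 1) (fun p => ?_) Q).trans
      (by omega)
    exact (MvPolynomial.totalDegree_add _ _).trans (by simp)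
  have hQ'a : ∀ F : Fin (n + 1) × Fin (n - 1) → K[X],
      MvPolynomial.aeval F Q' = MvPolynomial.aeval (fun p => F p + C (c p)) Q := by
    intro F
    rw [MvPolynomial.comp_aeval_apply]
    simp [C_eq_algebraMap]
  have hQ' : Q' ≠ 0 := by
    intro h0
    apply hQ
    have h1 := congrArg (MvPolynomial.aeval fun p => MvPolynomial.X p - MvPolynomial.C (c p)) h0
    rw [MvPolynomial.comp_aeval_apply, map_zero] at h1
    simpa [MvPolynomial.algebraMap_eq] using h1
  have hex : ∃ d, MvPolynomial.homogeneousComponent d Q' ≠ 0 := by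
    by_contra! h
    exact hQ' (by rw [← MvPolynomial.sum_homogeneousComponent Q',
      Finset.sum_eq_zero fun i _ => h i])
  classical
  obtain ⟨d, hd, hmin⟩ : ∃ d, MvPolynomial.homogeneousComponent d Q' ≠ 0 ∧
      ∀ j < d, MvPolynomial.homogeneousComponent j Q' = 0 :=
    ⟨Nat.find hex, Nat.find_spec hex, fun j hj => not_not.1 (Nat.find_min hex hj)⟩
  have hdE : d ≤ E := by
    by_contra! h
    exact hd (MvPolynomial.homogeneousComponent_eq_zero _ _ (hQ'E.trans_lt h))
  have hdK : (d : Cardinal) ≤ Cardinal.mk K := by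
    rw [Cardinal.mk_fintype, Nat.cast_le]
    have : 1 ≤ n * (n * n * 3) := Nat.succ_le_of_lt (by positivity)
    nlinarith
  obtain ⟨τ, hτ⟩ : ∃ τ, MvPolynomial.eval τ (MvPolynomial.homogeneousComponent d Q') ≠ 0 := by
    by_contra! h
    exact hd ((MvPolynomial.homogeneousComponent_isHomogeneous d
      Q').eq_zero_of_forall_eval_eq_zero_of_le_card h hdK)
  obtain ⟨Y, hY, hYτ⟩ := hg.exists_charDeriv_coeff hn (-τ)
  obtain ⟨x, hx1, hx2, hx3, hx4⟩ := isCurveVelocity_of_trace_eq_zero hY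
  let F : Fin (n + 1) × Fin (n - 1) → K[X] := fun p =>
    (x * (g p.1).1.map C).charpoly.coeff ((p.2 : ℕ) + 1)
  have heval : ∀ u p, (F p).eval u =
      (x.map (eval u) * (g p.1).1).charpoly.coeff ((p.2 : ℕ) + 1) := by
    intro u p
    have h1 : (x * (g p.1).1.map C).map (evalRingHom u) = x.map (eval u) * (g p.1).1 := by
      rw [Matrix.map_mul]
      congr 1
      ext; simp
    rw [← h1, charpoly_map, Polynomial.coeff_map]
    rfl
  have hF0 : ∀ p, (F p).coeff 0 = c p := by
    intro p
    rw [coeff_zero_eq_eval_zero, heval]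
    have : x.map (eval 0) = 1 := by
      rw [← hx3]; ext; simp [coeff_zero_eq_eval_zero]
    rw [this, one_mul]
  have hF1 : ∀ p, (F p).divX.coeff 0 = τ p := by
    intro p
    rw [coeff_divX, zero_add, coeff_one_charpoly_coeff x _ Y hx3 hx4, hYτ]
    simp
  have hFX : F = fun p => X * (F p).divX + C (c p) := by
    funext p
    rw [← hF0, X_mul, divX_mul_X_add]
  let G := MvPolynomial.aeval F Q
  have hG0 : G ≠ 0 := by
    intro h
    have h1 := coeff_aeval_eq_aeval_of_forall_lt hmin (fun p => (F p).divX)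
    rw [hQ'a, ← hFX] at h1
    simp only [hF1] at h1
    exact hτ (h1.symm.trans (by rw [show MvPolynomial.aeval F Q = 0 from h, coeff_zero]))
  have hGd : G.natDegree ≤ E * (n * (n * n * 3)) := by
    refine MvPolynomial.aeval_natDegree_le _ hE _ fun p => ?_
    have := natDegree_charpoly_coeff_le (x := x * (g p.1).1.map C) (ν := n * n * 3) (fun i j => ?_)
      ((p.2 : ℕ) + 1)
    · simpa using this
    · rw [Matrix.mul_apply]
      refine natDegree_sum_le_of_forall_le _ _ fun l _ => ?_
      rw [map_apply]
      refine (natDegree_mul_C_le _ _).trans ?_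
      simpa using hx2 i l
  obtain ⟨u, hu⟩ := exists_eval_ne_zero_of_natDegree_lt_card G hG0 (by
    rw [Cardinal.mk_fintype, Nat.cast_lt]; omega)
  refine ⟨⟨x.map (eval u), ?_⟩, ?_⟩
  · have := congrArg (evalRingHom u) hx1
    rw [RingHom.map_det, map_one] at this
    exact this
  · simp only [← heval]
    intro h
    apply hu
    rw [eval_aeval_mvPolynomial, h]

end KeyLemma

section Existence

open Matrix

theorem three_pow_add_three_pow_inj {a b c d : ℕ} (h : 3 ^ a + 3 ^ d = 3 ^ b + 3 ^ c)
    (hab : a ≠ b) :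
    a = c := by
  have key : ∀ x y : ℕ, x ≤ y → 3 ^ x ∣ 3 ^ x + 3 ^ y ∧ ¬ 3 ^ (x + 1) ∣ 3 ^ x + 3 ^ y := by
    intro x y hxy
    obtain ⟨k, rfl⟩ := Nat.exists_eq_add_of_le hxy
    rw [pow_add, pow_succ]
    refine ⟨Dvd.intro (1 + 3 ^ k) (by ring), fun h => ?_⟩
    have h1 : 3 ^ x * 3 ∣ 3 ^ x * (1 + 3 ^ k) := by convert h using 1; ring
    have h2 := Nat.dvd_of_mul_dvd_mul_left (by positivity) h1
    cases k with
    | zero => omega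
    | succ k => rw [pow_succ] at h2; omega
  have hmin : ∀ x y : ℕ, 3 ^ min x y ∣ 3 ^ x + 3 ^ y ∧ ¬ 3 ^ (min x y + 1) ∣ 3 ^ x + 3 ^ y := by
    intro x y
    rcases le_total x y with hxy | hxy
    · rw [min_eq_left hxy]; exact key x y hxy
    · rw [min_eq_right hxy, add_comm (3 ^ x)]; exact key y x hxy
  have hm : min a d = min b c := by
    have h1 := hmin a d
    have h2 := hmin b c
    rw [h] at h1
    rcases lt_trichotomy (min a d) (min b c) with hlt | heq | hlt
    · exact absurd ((pow_dvd_pow 3 hlt).trans h2.1) h1.2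
    · exact heq
    · exact absurd ((pow_dvd_pow 3 hlt).trans h1.1) h2.2
  have hinj : ∀ x y : ℕ, 3 ^ x = 3 ^ y → x = y := fun x y h =>
    Nat.pow_right_injective (by omega : 2 ≤ 3) h
  rcases le_total a d with h1 | h1 <;> rcases le_total b c with h2 | h2 <;>
    simp only [h1, h2, min_eq_left, min_eq_right] at hm
  · exact absurd hm hab
  · exact hm
  · subst hm
    exact hinj _ _ (by omega)
  · subst hm
    exact absurd (hinj _ _ (by omega)) hab

variable {K : Type*} [Field K]

/-- A cyclic shift matrix, rescaled to have determinant one. -/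
def signedShift (K : Type*) [Field K] (m : ℕ) : Matrix (Fin (m + 1)) (Fin (m + 1)) K :=
  diagonal (Function.update 1 0 ((Equiv.Perm.sign (finRotate (m + 1)) : ℤ) : K)) *
    (finRotate (m + 1)).permMatrix K

theorem det_signedShift (m : ℕ) : (signedShift K m).det = 1 := by
  rw [signedShift, det_mul, det_diagonal, det_permutation,
    Finset.prod_update_of_mem (Finset.mem_univ _)]
  simp only [Pi.one_apply, Finset.prod_const_one, mul_one]
  rw [← Int.cast_mul, ← Units.val_mul, Int.units_mul_self]
  simp

theorem exists_signedShift_pow (m j : ℕ) : ∃ ε : Fin (m + 1) → K, (∀ a, ε a ≠ 0) ∧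
    ∀ a b, (signedShift K m ^ j) a b = if b = a + Fin.ofNat (m + 1) j then ε a else 0 := by
  have h1 : ∃ ε : Fin (m + 1) → K, (∀ a, ε a ≠ 0) ∧
      ∀ a b, signedShift K m a b = if b = a + 1 then ε a else 0 := by
    refine ⟨Function.update 1 0 ((Equiv.Perm.sign (finRotate (m + 1)) : ℤ) : K), fun a => ?_,
      fun a b => ?_⟩
    · by_cases h : a = 0
      · subst h
        rw [Function.update_self]
        rcases Int.units_eq_one_or (Equiv.Perm.sign (finRotate (m + 1))) with h | h <;> simp [h]
      · rw [Function.update_of_ne h]; exact one_ne_zero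
    · rw [signedShift, diagonal_mul, Equiv.Perm.permMatrix, PEquiv.toMatrix_apply]
      simp [eq_comm]
  obtain ⟨ε, hε, hS⟩ := h1
  induction j with
  | zero => exact ⟨1, fun _ => one_ne_zero, fun a b => by
      simp [one_apply, eq_comm (a := b)]⟩
  | succ j ih =>
    obtain ⟨η, hη, hj⟩ := ih
    refine ⟨fun a => ε a * η (a + 1), fun a => mul_ne_zero (hε _) (hη _), fun a b => ?_⟩
    rw [pow_succ', mul_apply, Finset.sum_eq_single (a + 1)]
    · rw [hS, hj, if_pos rfl, mul_ite, mul_zero, add_assoc]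
      have : Fin.ofNat (m + 1) (j + 1) = 1 + Fin.ofNat (m + 1) j := by
        ext; simp [Fin.val_add, add_comm]
      rw [this]
    · intro c _ hc
      rw [hS, if_neg hc, zero_mul]
    · simp

theorem diagonal_conj_pow {ι : Type*} [Fintype ι] [DecidableEq ι] {v : ι → K} (hv : ∀ a, v a ≠ 0)
    (U : Matrix ι ι K) (j : ℕ) :
    (diagonal v * U * diagonal v⁻¹) ^ j = diagonal v * U ^ j * diagonal v⁻¹ := by
  have h1 : diagonal v⁻¹ * diagonal v = 1 := by
    rw [diagonal_mul_diagonal, ← diagonal_one]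
    congr 1; ext a; simp [hv a]
  have h2 : diagonal v * diagonal v⁻¹ = 1 := by
    rw [diagonal_mul_diagonal, ← diagonal_one]
    congr 1; ext a; simp [hv a]
  exact Units.conj_pow ⟨diagonal v, diagonal v⁻¹, h2, h1⟩ U j

theorem exists_injective_prod_eq_one {m : ℕ} {t : K} (ht : t ≠ 0)
    (hm : (m + 1) * (m + 1) < orderOf t) :
    ∃ d : Fin (m + 1) → K, Function.Injective d ∧ ∏ a, d a = 1 := by
  have hinj := pow_injOn_Iio_orderOf (x := t)
  set S := ∑ a : Fin m, ((a : ℕ) + 1) with hS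
  have hSle : S ≤ m * m := by
    refine (Finset.sum_le_card_nsmul Finset.univ (fun a : Fin m => (a : ℕ) + 1) m
      fun a _ => a.2).trans ?_
    simp
  refine ⟨Fin.cons (t ^ S)⁻¹ fun a : Fin m => t ^ ((a : ℕ) + 1), ?_, ?_⟩
  · rw [Fin.cons_injective_iff]
    constructor
    · rintro ⟨a, ha⟩
      have h1 : t ^ ((a : ℕ) + 1 + S) = t ^ 0 := by
        rw [pow_add, pow_zero]
        dsimp only at ha
        rw [ha, inv_mul_cancel₀ (pow_ne_zero _ ht)]
      have := hinj (Set.mem_Iio.2 (by nlinarith [a.2])) (Set.mem_Iio.2 (by omega)) h1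
      omega
    · intro a b hab
      have := hinj (Set.mem_Iio.2 (by nlinarith [a.2])) (Set.mem_Iio.2 (by nlinarith [b.2])) hab
      exact Fin.ext (by omega)
  · rw [Fin.prod_univ_succ]
    simp only [Fin.cons_zero, Fin.cons_succ]
    rw [Finset.prod_pow_eq_pow_sum, inv_mul_cancel₀ (pow_ne_zero _ ht)]

theorem exists_powersSeparate {m : ℕ} {t : K} (ht : t ≠ 0)
    (hm : (m + 1) * (m + 1) + 2 * 3 ^ (m + 1) < orderOf t) :
    ∃ g : Fin (m + 1 + 1) → SpecialLinearGroup (Fin (m + 1)) K, PowersSeparate g := by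
  have hinj := pow_injOn_Iio_orderOf (x := t)
  obtain ⟨d, hd, hd1⟩ := exists_injective_prod_eq_one (m := m) ht (by omega)
  let s : Fin (m + 1) → K := fun a => t ^ 3 ^ (a : ℕ)
  have hs : ∀ a, s a ≠ 0 := fun a => pow_ne_zero _ ht
  have hsinj : ∀ c : Fin (m + 1), c ≠ 0 → Function.Injective fun a => s a * (s (a + c))⁻¹ := by
    intro c hc a b hab
    by_contra hne
    have h1 : t ^ (3 ^ (a : ℕ) + 3 ^ ((b + c : Fin (m + 1)) : ℕ)) =
        t ^ (3 ^ (b : ℕ) + 3 ^ ((a + c : Fin (m + 1)) : ℕ)) := by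
      rw [pow_add, pow_add]
      have h2 := hs (a + c)
      have h3 := hs (b + c)
      dsimp only at hab
      rw [← div_eq_mul_inv, ← div_eq_mul_inv, div_eq_div_iff h2 h3] at hab
      exact hab
    have hb : ∀ x y : Fin (m + 1), 3 ^ (x : ℕ) + 3 ^ (y : ℕ) < orderOf t := by
      intro x y
      have h1 := Nat.pow_le_pow_right (n := 3) (by norm_num) x.2.le
      have h2 := Nat.pow_le_pow_right (n := 3) (by norm_num) y.2.le
      omega
    have h4 := three_pow_add_three_pow_inj (hinj (hb _ _) (hb _ _) h1) (fun h => hne (Fin.ext h))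
    apply hc
    have h5 : a = a + c := Fin.ext h4
    simpa using h5
  let v : Fin (m + 1) → Fin (m + 1) → K := fun i a => s a ^ (i : ℕ)
  have hv : ∀ i a, v i a ≠ 0 := fun i a => pow_ne_zero _ (hs a)
  let g : Fin (m + 1 + 1) → SpecialLinearGroup (Fin (m + 1)) K := Fin.cons
    ⟨diagonal d, by rw [det_diagonal, hd1]⟩ fun i =>
      ⟨diagonal (v i) * signedShift K m * diagonal (v i)⁻¹, by
        rw [det_mul, det_mul, det_signedShift, mul_one, det_diagonal, det_diagonal,
          ← Finset.prod_mul_distrib]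
        exact Finset.prod_eq_one fun a _ => mul_inv_cancel₀ (hv i a)⟩
  have hg0 : (g 0).1 = diagonal d := rfl
  have hgs : ∀ i : Fin (m + 1),
      (g i.succ).1 = diagonal (v i) * signedShift K m * diagonal (v i)⁻¹ := fun i => rfl
  refine ⟨g, fun Y hY htr => ?_⟩
  have hdiag : ∀ a, Y a a = 0 := by
    refine congrFun (eq_zero_of_forall_pow_sum_mul_pow_eq_zero hd fun k => ?_)
    rcases Nat.eq_zero_or_pos (k : ℕ) with hk | hk
    · simpa [hk, trace] using hY
    · have := htr 0 ⟨k - 1, by omega⟩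
      simp only [Nat.sub_add_cancel hk] at this
      rw [hg0, diagonal_pow] at this
      simpa [trace, diagonal_mul, mul_comm] using this
  ext a b
  rw [Matrix.zero_apply]
  by_cases hab : a = b
  · subst hab; exact hdiag a
  have hc : a - b ≠ 0 := sub_ne_zero.2 hab
  have hcpos : 0 < ((a - b : Fin (m + 1)) : ℕ) := Nat.pos_of_ne_zero fun h => hc (Fin.ext h)
  obtain ⟨ε, hε, hU⟩ := exists_signedShift_pow (K := K) m ((a - b : Fin (m + 1)) : ℕ)
  have hz := eq_zero_of_forall_pow_sum_mul_pow_eq_zero (hsinj _ hc)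
    (v := fun x => ε x * Y (x + (a - b)) x) fun i => by
      have := htr i.succ ⟨((a - b : Fin (m + 1)) : ℕ) - 1, by omega⟩
      simp only [Nat.sub_add_cancel hcpos] at this
      rw [hgs, diagonal_conj_pow (hv i), trace] at this
      rw [← this]
      refine Finset.sum_congr rfl fun x _ => ?_
      rw [diag_apply, Matrix.mul_apply, Finset.sum_eq_single (x + (a - b))]
      · simp only [mul_diagonal, diagonal_mul, hU, Fin.ofNat_val_eq_self, if_true, v, Pi.inv_apply,
          mul_pow, inv_pow]
        ring
      · intro y _ hy
        simp only [mul_diagonal, diagonal_mul, hU, Fin.ofNat_val_eq_self, if_neg hy]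
        ring
      · simp
  have := congrFun hz b
  simpa [hε b] using this

end Existence

section Escape

open Matrix

variable {n : ℕ} {K : Type*} [Field K]

/-- The matrix whose rows are the entries of `1` and of the powers `g i ^ (k + 1)`, listed along
an indexing `e`. -/
def powerMatrix {m : ℕ} (e : Fin n × Fin n → Option (Fin m × Fin (n - 1)))
    (g : Fin m → SpecialLinearGroup (Fin n) K) (r p : Fin n × Fin n) : K :=
  (e r).elim ((1 : Matrix (Fin n) (Fin n) K) p.1 p.2)
    fun q => ((g q.1).1 ^ ((q.2 : ℕ) + 1)) p.1 p.2

theorem powersSeparate_iff_det_ne_zero {m : ℕ}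
    (e : Fin n × Fin n ≃ Option (Fin m × Fin (n - 1)))
    (g : Fin m → SpecialLinearGroup (Fin n) K) :
    PowersSeparate g ↔ (of (powerMatrix e g)).det ≠ 0 := by
  have htr : ∀ M Y : Matrix (Fin n) (Fin n) K, (M * Y).trace = ∑ p : Fin n × Fin n,
      M p.1 p.2 * Y p.2 p.1 := by
    intro M Y
    simp only [trace, diag_apply, Matrix.mul_apply, Fintype.sum_prod_type]
  have hmul : ∀ v : Fin n × Fin n → K, of (powerMatrix e g) *ᵥ v = 0 ↔
      (of fun a b => v (b, a) : Matrix (Fin n) (Fin n) K).trace = 0 ∧ ∀ i, ∀ k : Fin (n - 1),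
        ((g i).1 ^ ((k : ℕ) + 1) * of fun a b => v (b, a)).trace = 0 := by
    intro v
    have h1 : ∀ r, (of (powerMatrix e g) *ᵥ v) r =
        ((e r).elim (1 : Matrix (Fin n) (Fin n) K) (fun q => (g q.1).1 ^ ((q.2 : ℕ) + 1)) *
          of fun a b => v (b, a)).trace := by
      intro r
      rw [htr, mulVec, dotProduct]
      refine Finset.sum_congr rfl fun p _ => ?_
      rw [of_apply, of_apply, powerMatrix]
      cases e r <;> rfl
    constructor
    · intro h
      constructor
      · simpa [h] using (h1 (e.symm none)).symm
      · intro i k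
        simpa [h] using (h1 (e.symm (some (i, k)))).symm
    · rintro ⟨h2, h3⟩
      ext r
      rw [h1, Pi.zero_apply]
      rcases e r with _ | ⟨i, k⟩
      · simpa using h2
      · exact h3 i k
  rw [← not_iff_not, not_not, ← exists_mulVec_eq_zero_iff, PowersSeparate]
  push Not
  constructor
  · rintro ⟨Y, h1, h2, h3⟩
    refine ⟨fun p => Y p.2 p.1, fun h => h3 ?_, (hmul _).2 ⟨h1, h2⟩⟩
    ext a b
    exact congrFun h (b, a)
  · rintro ⟨v, h1, h2⟩
    obtain ⟨h3, h4⟩ := (hmul v).1 h2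
    refine ⟨_, h3, h4, fun h => h1 ?_⟩
    ext p
    exact congrFun₂ h p.2 p.1

theorem exists_powersSeparate_mem_prodSet (hn : 0 < n) {A : Set (SpecialLinearGroup (Fin n) K)}
    (hA : Subgroup.closure A = ⊤)
    (h : ∃ g : Fin (n + 1) → SpecialLinearGroup (Fin n) K, PowersSeparate g) :
    ∃ g : Fin (n + 1) → SpecialLinearGroup (Fin n) K, PowersSeparate g ∧
      ∀ i, g i ∈ prodSet A ((n * n + 1) ^ (n * (n * n))) := by
  classical
  have hcard : Fintype.card (Fin n × Fin n) =
      Fintype.card (Option (Fin (n + 1) × Fin (n - 1))) := by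
    simp only [Fintype.card_option, Fintype.card_prod, Fintype.card_fin]
    obtain ⟨m, rfl⟩ : ∃ m, n = m + 1 := ⟨n - 1, by omega⟩
    simp; ring
  let e := Fintype.equivOfCardEq hcard
  suffices H : ∀ s : Finset (Fin (n + 1)), ∃ g : Fin (n + 1) → SpecialLinearGroup (Fin n) K,
      PowersSeparate g ∧ ∀ i ∈ s, g i ∈ prodSet A ((n * n + 1) ^ (n * (n * n))) by
    obtain ⟨g, h1, h2⟩ := H Finset.univ
    exact ⟨g, h1, fun i => h2 i (Finset.mem_univ i)⟩
  intro s
  induction s using Finset.induction_on with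
  | empty => obtain ⟨g, hg⟩ := h; exact ⟨g, hg, by simp⟩
  | insert i s hi ih =>
    obtain ⟨g, hg, hgs⟩ := ih
    have hF : (fun x => (of fun r p => powerMatrix e (Function.update g i x) r p).det) ∈
        polyFun n K (n * Fintype.card (Fin n × Fin n)) := by
      refine det_mem_polyFun (fun r p x => powerMatrix e (Function.update g i x) r p) fun r p => ?_
      simp only [powerMatrix]
      rcases e r with _ | ⟨j, k⟩
      · exact const_mem_polyFun _ _
      · by_cases hj : j = i
        · subst hj
          simp only [Option.elim_some, Function.update_self]
          exact polyFun_mono (by omega) (pow_entry_mem_polyFun _ _ _)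
        · simp only [Option.elim_some, Function.update_of_ne hj]
          exact const_mem_polyFun _ _
    obtain ⟨x, hx, hx0⟩ : ∃ x ∈ prodSet A ((n * n + 1) ^ (n * (n * n))),
        (of fun r p => powerMatrix e (Function.update g i x) r p).det ≠ 0 := by
      by_contra! hcon
      rw [Fintype.card_prod, Fintype.card_fin] at hF
      have h0 := eq_zero_of_forall_mem_prodSet _ (fun f hf y => comp_mul_left_mem_polyFun hf y) hA
        (polyFun_finrank_le (K := K) _).2 hF hcon
      have h1 := congrFun h0 (g i)
      rw [Function.update_eq_self] at h1
      exact (powersSeparate_iff_det_ne_zero e g).1 hg h1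
    refine ⟨Function.update g i x, (powersSeparate_iff_det_ne_zero e _).2 hx0, fun j hj => ?_⟩
    by_cases hji : j = i
    · subst hji; rwa [Function.update_self]
    · rw [Function.update_of_ne hji]
      exact hgs j (Finset.mem_of_mem_insert_of_ne hj hji)

end Escape

section Separable

open Matrix Polynomial

theorem isSemisimpleElt_of_separable {n : ℕ} {K : Type*} [Field K]
    {g : SpecialLinearGroup (Fin n) K} (h : g.1.charpoly.Separable) : IsSemisimpleElt n K g := by
  classical
  set L := AlgebraicClosure K
  set M : Matrix (Fin n) (Fin n) L := g.1.map (algebraMap K L) with hM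
  have hsep : M.charpoly.Separable := by rw [hM, charpoly_map]; exact h.map
  have hcard : Fintype.card M.charpoly.roots.toFinset = Fintype.card (Fin n) := by
    rw [Fintype.card_coe, Multiset.toFinset_card_of_nodup (nodup_roots hsep),
      splits_iff_card_roots.1 (IsAlgClosed.splits _), charpoly_natDegree_eq_dim]
  let r := (Fintype.equivOfCardEq hcard).symm
  have hr : ∀ i, (M.charpoly).IsRoot (r i : L) := fun i =>
    isRoot_of_mem_roots (Multiset.mem_toFinset.1 (r i).2)
  have hvec : ∀ i, ∃ v : Fin n → L, Module.End.HasEigenvector (toLin' M) (r i : L) v := by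
    intro i
    have h1 : Module.End.HasEigenvalue (toLin' M) (r i : L) := by
      rw [Module.End.hasEigenvalue_iff_isRoot_charpoly, Matrix.charpoly_toLin']
      exact hr i
    exact h1.exists_hasEigenvector
  choose v hv using hvec
  have hli : LinearIndependent L v := Module.End.eigenvectors_linearIndependent' (toLin' M)
    (fun i => (r i : L)) (Subtype.val_injective.comp r.injective) v hv
  let P : Matrix (Fin n) (Fin n) L := of fun a i => v i a
  have hP : IsUnit P := by
    rw [← linearIndependent_cols_iff_isUnit]
    exact hli
  obtain ⟨u, hu⟩ := hP
  refine ⟨u, diagonal fun i => (r i : L), isDiag_diagonal _, ?_⟩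
  have hmul : M * P = P * diagonal fun i => (r i : L) := by
    ext a i
    have := congrFun (hv i).apply_eq_smul a
    rw [toLin'_apply] at this
    rw [mul_diagonal]
    rw [Matrix.mul_apply]
    simpa [mulVec, dotProduct, P, mul_comm] using this
  rw [← hu] at hmul
  rw [← hmul, mul_assoc, Units.mul_inv, mul_one]

/-- The monic polynomial of degree `n` with constant coefficient `(-1) ^ n` and with prescribed
intermediate coefficients. -/
noncomputable def unimodularPoly {R : Type*} [CommRing R] (n : ℕ) (c : Fin (n - 1) → R) : R[X] :=
  X ^ n + ∑ k : Fin (n - 1), C (c k) * X ^ ((k : ℕ) + 1) + C ((-1) ^ n)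

theorem unimodularPoly_map {R S : Type*} [CommRing R] [CommRing S] (f : R →+* S) {n : ℕ}
    (c : Fin (n - 1) → R) :
    (unimodularPoly n c).map f = unimodularPoly n (fun k => f (c k)) := by
  simp [unimodularPoly, Polynomial.map_sum]

theorem unimodularPoly_charpoly {n : ℕ} (hn : 0 < n) {K : Type*} [Field K]
    (x : SpecialLinearGroup (Fin n) K) :
    unimodularPoly n (fun k => x.1.charpoly.coeff ((k : ℕ) + 1)) = x.1.charpoly := by
  have hdeg : x.1.charpoly.natDegree = n := by simp
  have h0 : x.1.charpoly.coeff 0 = (-1) ^ n := by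
    have hdet := det_eq_sign_charpoly_coeff x.1
    rw [x.2, Fintype.card_fin] at hdet
    have h3 := congrArg (((-1 : K) ^ n) * ·) hdet
    simpa [← mul_assoc, ← mul_pow] using h3.symm
  have hlead : x.1.charpoly.coeff n = 1 := by
    have := x.1.charpoly_monic
    rwa [Monic, leadingCoeff, hdeg] at this
  conv_rhs => rw [as_sum_range_C_mul_X_pow x.1.charpoly, hdeg, Finset.sum_range_succ, hlead]
  obtain ⟨m, rfl⟩ : ∃ m, n = m + 1 := ⟨n - 1, by omega⟩
  rw [Finset.sum_range_succ', h0, unimodularPoly, ← Fin.sum_univ_eq_sum_range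
    (fun k => C (x.1.charpoly.coeff (k + 1)) * X ^ (k + 1))]
  simp only [C_1, pow_zero, mul_one, one_mul]
  rw [add_assoc, add_comm]
  rfl

/-- The discriminant of `unimodularPoly`, as a polynomial in its intermediate coefficients. -/
noncomputable def unimodularDiscr (n : ℕ) (K : Type*) [Field K] : MvPolynomial (Fin (n - 1)) K :=
  resultant (unimodularPoly n MvPolynomial.X) (unimodularPoly n MvPolynomial.X).derivative n (n - 1)

theorem eval_unimodularDiscr_ne_zero {n : ℕ} (hn : 0 < n) {K : Type*} [Field K]
    (x : SpecialLinearGroup (Fin n) K) :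
    MvPolynomial.eval (fun k : Fin (n - 1) => x.1.charpoly.coeff ((k : ℕ) + 1))
      (unimodularDiscr n K) ≠ 0 ↔ x.1.charpoly.Separable := by
  rw [unimodularDiscr, ← resultant_map_map, ← derivative_map, unimodularPoly_map]
  have hu : (unimodularPoly n fun k => MvPolynomial.eval (fun k : Fin (n - 1) =>
      x.1.charpoly.coeff ((k : ℕ) + 1)) (MvPolynomial.X k)) = x.1.charpoly :=
    (congrArg (unimodularPoly n) (funext fun k => MvPolynomial.eval_X k)).trans
      (unimodularPoly_charpoly hn x)
  rw [hu]
  have hdeg : x.1.charpoly.natDegree = n := by simp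
  have hd : x.1.charpoly.derivative.natDegree ≤ n - 1 := by
    simpa [hdeg] using natDegree_derivative_le x.1.charpoly
  obtain ⟨k, hk⟩ := Nat.exists_eq_add_of_le hd
  have hlead : x.1.charpoly.coeff n = 1 := by
    have := x.1.charpoly_monic
    rwa [Monic, leadingCoeff, hdeg] at this
  rw [hk, resultant_add_right_deg _ _ _ _ _ le_rfl, hlead, one_pow, one_mul, Separable,
    ← isUnit_resultant_iff_isCoprime x.1.charpoly_monic, hdeg, isUnit_iff_ne_zero]

theorem MvPolynomial.totalDegree_det_le {R σ ι : Type*} [CommRing R] [Fintype ι] [DecidableEq ι]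
    {M : Matrix ι ι (MvPolynomial σ R)} {e : ℕ} (h : ∀ i j, (M i j).totalDegree ≤ e) :
    M.det.totalDegree ≤ Fintype.card ι * e := by
  rw [det_apply]
  refine totalDegree_finsetSum_le fun s _ => ?_
  have h1 : (∏ i, M (s i) i).totalDegree ≤ Fintype.card ι * e := by
    refine (totalDegree_finsetProd _ _).trans ?_
    refine (Finset.sum_le_card_nsmul _ _ _ fun i _ => h (s i) i).trans ?_
    simp
  rcases Int.units_eq_one_or (Equiv.Perm.sign s) with hs | hs <;> rw [hs]
  · simpa using h1
  · simpa using h1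

theorem totalDegree_unimodularDiscr_le (n : ℕ) (K : Type*) [Field K] :
    (unimodularDiscr n K).totalDegree ≤ 2 * n := by
  have h1 : ∀ k, ((unimodularPoly n (MvPolynomial.X : Fin (n - 1) → MvPolynomial _ K)).coeff
      k).totalDegree ≤ 1 := by
    intro k
    simp only [unimodularPoly, coeff_add, finsetSum_coeff, coeff_X_pow, coeff_C_mul, coeff_C]
    refine (MvPolynomial.totalDegree_add _ _).trans (max_le ?_ ?_)
    · refine (MvPolynomial.totalDegree_add _ _).trans (max_le ?_ ?_)
      · split_ifs <;> simp
      · refine MvPolynomial.totalDegree_finsetSum_le fun i _ => ?_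
        split_ifs <;> simp
    · split_ifs
      · rcases neg_one_pow_eq_or (MvPolynomial (Fin (n - 1)) K) n with h | h <;> rw [h] <;> simp
      · simp
  have h2 : ∀ k, ((unimodularPoly n (MvPolynomial.X : Fin (n - 1) → MvPolynomial _
      K)).derivative.coeff k).totalDegree ≤ 1 := by
    intro k
    rw [coeff_derivative]
    refine (MvPolynomial.totalDegree_mul _ _).trans ?_
    have : ((k : MvPolynomial (Fin (n - 1)) K) + 1).totalDegree = 0 := by
      have := MvPolynomial.totalDegree_C (σ := Fin (n - 1)) ((k : K) + 1)
      simpa using this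
    rw [this]
    exact h1 _
  refine (MvPolynomial.totalDegree_det_le (e := 1) fun i j => ?_).trans ?_
  · induction j using Fin.addCases with
    | left j =>
      simp only [sylvester, of_apply, Fin.addCases_left]
      split_ifs
      · exact h2 _
      · simp
    | right j =>
      simp only [sylvester, of_apply, Fin.addCases_right]
      split_ifs
      · exact h1 _
      · simp
  · rw [Fintype.card_fin]; omega

theorem unimodularDiscr_ne_zero {m : ℕ} {K : Type*} [Field K] {t : K} (ht : t ≠ 0)
    (hm : (m + 1) * (m + 1) < orderOf t) : unimodularDiscr (m + 1) K ≠ 0 := by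
  obtain ⟨d, hd, hd1⟩ := exists_injective_prod_eq_one ht hm
  intro h
  refine (eval_unimodularDiscr_ne_zero (Nat.succ_pos m)
    ⟨diagonal d, by rw [det_diagonal, hd1]⟩).2 ?_ (by rw [h, map_zero])
  rw [charpoly_diagonal]
  exact separable_prod_X_sub_C_iff.2 hd

end Separable

section Assembly

open Matrix Polynomial

theorem exists_fibre_card_le {n : ℕ} {K : Type*} [Field K] (hn : 0 < n) {ι : Type*} [Fintype ι]
    (hι : Fintype.card ι = n * n - 1) (f : ι → SpecialLinearGroup (Fin n) K → K)
    (hf : ∀ i, f i ∈ polyFun n K n) :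
    ∃ R : MvPolynomial ι K, R ≠ 0 ∧
      R.totalDegree ≤ n * n * ((n * n - 1) * relDegree n) ∧
      ∀ v, MvPolynomial.eval v R ≠ 0 → ∀ S : Finset (SpecialLinearGroup (Fin n) K),
        (∀ x ∈ S, ∀ i, f i x = v i) → S.card ≤ relDegree n ^ (n * n) := by
  classical
  choose c hc hdeg hrel using fun p => exists_relation hn hι f hf (entryFn_mem (K := K) (n := n) p)
  choose β hβ using hc
  refine ⟨∏ p, c p (β p), Finset.prod_ne_zero_iff.2 fun p _ => hβ p, ?_, fun v hv S hS => ?_⟩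
  · refine (MvPolynomial.totalDegree_finsetProd _ _).trans ?_
    refine (Finset.sum_le_card_nsmul _ _ _ fun p _ => hdeg p (β p)).trans ?_
    simp
  · rw [map_prod, Finset.prod_ne_zero_iff] at hv
    let P : Fin n × Fin n → K[X] := fun p => ∑ b, C (MvPolynomial.eval v (c p b)) * X ^ (b : ℕ)
    have hcoeff : ∀ p b, (P p).coeff (b : Fin (relDegree n)) = MvPolynomial.eval v (c p b) := by
      intro p b
      simp only [P, finsetSum_coeff, coeff_C_mul, coeff_X_pow]
      rw [Finset.sum_eq_single b]
      · simp
      · intro b' _ hb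
        rw [if_neg fun h => hb (Fin.ext h.symm), mul_zero]
      · simp
    have hP : ∀ p, P p ≠ 0 := fun p h => hv p (Finset.mem_univ p) (by rw [← hcoeff, h, coeff_zero])
    have hPdeg : ∀ p, (P p).natDegree ≤ relDegree n := fun p =>
      natDegree_sum_le_of_forall_le _ _ fun b _ => (natDegree_C_mul_X_pow_le _ _).trans b.2.le
    have hle : S.card ≤ (Fintype.piFinset fun p => (P p).roots.toFinset).card := by
      refine Finset.card_le_card_of_injOn (fun x p => entryFn n K p x) ?_ ?_
      · intro x hx
        rw [Finset.mem_coe, Fintype.mem_piFinset]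
        intro p
        rw [Multiset.mem_toFinset, mem_roots (hP p), IsRoot.def, eval_finsetSum]
        have := hrel p x
        rw [funext (hS x hx)] at this
        simpa using this
      · intro x _ y _ hxy
        exact Subtype.ext (Matrix.ext fun a b => congrFun hxy (a, b))
    refine hle.trans ?_
    rw [Fintype.card_piFinset]
    refine (Finset.prod_le_pow_card _ _ _ fun p _ =>
      ((Multiset.toFinset_card_le _).trans (card_roots' _)).trans (hPdeg p)).trans ?_
    simp

theorem charpoly_eq_of_isConj {n : ℕ} {K : Type*} [Field K] {x y : SpecialLinearGroup (Fin n) K}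
    (h : IsConj x y) : x.1.charpoly = y.1.charpoly := by
  obtain ⟨c, rfl⟩ := isConj_iff.1 h
  have h1 : (c * x * c⁻¹).1 = (c * x).1 * (c⁻¹).1 := rfl
  have h2 : (c⁻¹).1 * (c * x).1 = x.1 := congrArg Subtype.val (inv_mul_cancel_left c x)
  rw [h1, charpoly_mul_comm, h2]

/-- The exponent of the product set in which translating elements can be found. -/
def escapeDegree (n : ℕ) : ℕ :=
  (n * n + 1) ^ (n * (n * n * ((n * n - 1) * relDegree n) + (n + 1) * (2 * n)))

/-- The exponent of the product set whose semisimple classes are counted. -/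
def classExponent (n : ℕ) : ℕ :=
  1 + escapeDegree n + (n * n + 1) ^ (n * (n * n))

theorem card_le_of_unimodularDiscr_ne_zero {n : ℕ} (hn : 0 < n) {K : Type*} [Field K] [Fintype K]
    (hdiscr : unimodularDiscr n K ≠ 0)
    (hsep : ∃ g : Fin (n + 1) → SpecialLinearGroup (Fin n) K, PowersSeparate g)
    (hK : (n * n * ((n * n - 1) * relDegree n) + (n + 1) * (2 * n)) * (n * (n * n * 3)) <
      Fintype.card K)
    {A : Set (SpecialLinearGroup (Fin n) K)} (hA : Subgroup.closure A = ⊤) :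
    A.ncard ≤ escapeDegree n * (relDegree n ^ (n * n) *
      (ConjClasses.mk '' {g ∈ prodSet A (classExponent n) | IsSemisimpleElt n K g}).ncard ^
        (n + 1)) := by
  classical
  obtain ⟨g, hg, hgA⟩ := exists_powersSeparate_mem_prodSet hn hA hsep
  let f : Fin (n + 1) × Fin (n - 1) → SpecialLinearGroup (Fin n) K → K := fun p x =>
    (x.1 * (g p.1).1).charpoly.coeff ((p.2 : ℕ) + 1)
  have hf : ∀ p, f p ∈ polyFun n K n := fun p => charpoly_coeff_mem_polyFun (by omega) (g p.1)
  have hcard : Fintype.card (Fin (n + 1) × Fin (n - 1)) = n * n - 1 := by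
    obtain ⟨m, rfl⟩ : ∃ m, n = m + 1 := ⟨n - 1, by omega⟩
    rw [Fintype.card_prod, Fintype.card_fin, Fintype.card_fin, Nat.add_sub_cancel]
    refine (Nat.sub_eq_of_eq_add ?_).symm
    ring
  obtain ⟨R, hR, hRdeg, hRfib⟩ := exists_fibre_card_le hn hcard f hf
  let Δ : Fin (n + 1) → MvPolynomial (Fin (n + 1) × Fin (n - 1)) K := fun i =>
    MvPolynomial.rename (fun k => (i, k)) (unimodularDiscr n K)
  have hΔ : ∀ i, Δ i ≠ 0 := fun i h => hdiscr
    (MvPolynomial.rename_injective _ (Prod.mk_right_injective i) (h.trans (map_zero _).symm))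
  have hΔdeg : (∏ i, Δ i).totalDegree ≤ (n + 1) * (2 * n) := by
    refine (MvPolynomial.totalDegree_finsetProd _ _).trans ?_
    refine (Finset.sum_le_card_nsmul _ _ _ fun i _ =>
      (MvPolynomial.totalDegree_rename_le _ _).trans (totalDegree_unimodularDiscr_le n K)).trans ?_
    simp
  have hQ : R * ∏ i, Δ i ≠ 0 := mul_ne_zero hR (Finset.prod_ne_zero_iff.2 fun i _ => hΔ i)
  have hQdeg := (MvPolynomial.totalDegree_mul R (∏ i, Δ i)).trans (add_le_add hRdeg hΔdeg)
  let B : SpecialLinearGroup (Fin n) K → K := fun x =>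
    MvPolynomial.eval (fun p => f p x) (R * ∏ i, Δ i)
  obtain ⟨x₀, hx₀⟩ : ∃ x, B x ≠ 0 := hg.exists_eval_ne_zero hn hQ hQdeg hK
  have hB := eval_mem_polyFun _ hQdeg f hf
  set V := polyFun n K (n * (n * n * ((n * n - 1) * relDegree n) + (n + 1) * (2 * n)))
  have hV : Module.finrank K V ≤ escapeDegree n := (polyFun_finrank_le _).2
  obtain ⟨H, hHA, hHcard, hH⟩ := exists_finset_vanishing V (prodSet A (escapeDegree n))
  have hesc : ∀ a, ∃ h ∈ H, B (a * h) ≠ 0 := by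
    intro a
    by_contra! h
    have hBa : (fun x => B (a * x)) ∈ V := comp_mul_left_mem_polyFun hB a
    have := eq_zero_of_forall_mem_prodSet V (fun F hF y => comp_mul_left_mem_polyFun hF y) hA hV hBa
      (hH _ hBa h)
    exact hx₀ (by simpa using congrFun this (a⁻¹ * x₀))
  have hB_iff : ∀ x, B x ≠ 0 → MvPolynomial.eval (fun p => f p x) R ≠ 0 ∧
      ∀ i, IsSemisimpleElt n K (x * g i) := by
    intro x hx
    have hx' := mul_ne_zero_iff.1
      ((map_mul (MvPolynomial.eval fun p => f p x) _ _).symm.trans_ne hx)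
    refine ⟨hx'.1, fun i => isSemisimpleElt_of_separable
      ((eval_unimodularDiscr_ne_zero hn (x * g i)).1 ?_)⟩
    have := hx'.2
    rw [map_prod, Finset.prod_ne_zero_iff] at this
    have := this i (Finset.mem_univ i)
    rwa [MvPolynomial.eval_rename] at this
  set T := ConjClasses.mk '' {g ∈ prodSet A (classExponent n) | IsSemisimpleElt n K g}
  have hTfin : T.Finite := T.toFinite
  rw [Set.ncard_eq_toFinset_card T hTfin, Set.ncard_eq_toFinset_card A A.toFinite]
  let A' : SpecialLinearGroup (Fin n) K → Finset (SpecialLinearGroup (Fin n) K) := fun h =>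
    {a ∈ A.toFinite.toFinset | B (a * h) ≠ 0}
  have hcover : A.toFinite.toFinset ⊆ H.biUnion A' := by
    intro a ha
    obtain ⟨h, hh, hah⟩ := hesc a
    exact Finset.mem_biUnion.2 ⟨h, hh, Finset.mem_filter.2 ⟨ha, hah⟩⟩
  refine (Finset.card_le_card hcover).trans ((Finset.card_biUnion_le_card_mul _ _ _ ?_).trans
    (Nat.mul_le_mul_right _ (hHcard.trans hV)))
  intro h hh
  have hpi : (Fintype.piFinset fun _ : Fin (n + 1) => hTfin.toFinset).card =
      hTfin.toFinset.card ^ (n + 1) := by simp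
  rw [← hpi]
  refine Finset.card_le_mul_card_image_of_maps_to
    (f := fun a i => ConjClasses.mk (a * h * g i)) ?_ _ ?_
  · intro a ha
    obtain ⟨haA, hah⟩ := Finset.mem_filter.1 ha
    refine Fintype.mem_piFinset.2 fun i => hTfin.mem_toFinset.2 ⟨_, ⟨?_, (hB_iff _ hah).2 i⟩, rfl⟩
    exact mul_mem_prodSet (mul_mem_prodSet (mem_prodSet_one (A.toFinite.mem_toFinset.1 haA))
      (hHA hh)) (hgA i)
  · intro b _
    rcases Finset.eq_empty_or_nonempty {a ∈ A' h | (fun i => ConjClasses.mk (a * h * g i)) = b}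
      with he | ⟨a₀, ha₀⟩
    · rw [he]; simp
    · obtain ⟨ha₀, hb₀⟩ := Finset.mem_filter.1 ha₀
      rw [← Finset.card_image_of_injective _ (mul_left_injective h)]
      refine hRfib _ (hB_iff _ (Finset.mem_filter.1 ha₀).2).1 _ ?_
      intro x hx p
      obtain ⟨a, ha, rfl⟩ := Finset.mem_image.1 hx
      have hab := congrFun ((Finset.mem_filter.1 ha).2.trans hb₀.symm) p.1
      have := charpoly_eq_of_isConj (ConjClasses.mk_eq_mk_iff_isConj.1 hab)
      exact congrArg (fun P => coeff P ((p.2 : ℕ) + 1)) this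

/-- A bound on the size of the finite fields which are treated trivially. -/
def fieldBound (n : ℕ) : ℕ :=
  (n * n * ((n * n - 1) * relDegree n) + (n + 1) * (2 * n)) * (n * (n * n * 3)) +
    (n * n + 2 * 3 ^ n + 1)

theorem ncard_le_mul_ncard_pow {n : ℕ} (hn : 0 < n) {K : Type*} [Field K] [Fintype K]
    {A : Set (SpecialLinearGroup (Fin n) K)} (hA : Subgroup.closure A = ⊤) :
    A.ncard ≤ (escapeDegree n * relDegree n ^ (n * n) + fieldBound n ^ (n * n)) *
      (ConjClasses.mk '' {g ∈ prodSet A (classExponent n) | IsSemisimpleElt n K g}).ncard ^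
        (n + 1) := by
  classical
  rcases lt_or_ge (fieldBound n) (Fintype.card K) with hK | hK
  · obtain ⟨m, rfl⟩ : ∃ m, n = m + 1 := ⟨n - 1, by omega⟩
    obtain ⟨t, ht⟩ := IsCyclic.exists_generator (α := Kˣ)
    have hord : orderOf (t : K) = Fintype.card K - 1 := by
      rw [orderOf_units, orderOf_eq_card_of_forall_mem_zpowers ht, Nat.card_units,
        Nat.card_eq_fintype_card]
    rw [fieldBound] at hK
    have hdiscr := unimodularDiscr_ne_zero (m := m) t.ne_zero (by omega)
    have hsep := exists_powersSeparate (m := m) t.ne_zero (by omega)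
    have := card_le_of_unimodularDiscr_ne_zero hn hdiscr hsep (by omega) hA
    rw [← mul_assoc] at this
    exact this.trans (Nat.mul_le_mul_right _ (Nat.le_add_right _ _))
  · have h1 : A.ncard ≤ fieldBound n ^ (n * n) := by
      refine (Set.ncard_le_card A).trans ?_
      refine (Nat.card_le_card_of_injective (β := Matrix (Fin n) (Fin n) K) Subtype.val
        Subtype.val_injective).trans ?_
      have : Nat.card (Matrix (Fin n) (Fin n) K) = Fintype.card K ^ (n * n) := by
        simp [Matrix, pow_mul]
      rw [this]
      exact Nat.pow_le_pow_left hK _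
    have h2 : 0 < (ConjClasses.mk ''
        {g ∈ prodSet A (classExponent n) | IsSemisimpleElt n K g}).ncard := by
      refine (Set.ncard_pos (Set.toFinite _)).2 ⟨_, 1, ⟨one_mem_prodSet A _, 1, 1, isDiag_one, ?_⟩,
        rfl⟩
      simp
    exact (h1.trans (Nat.le_add_left _ _)).trans (Nat.le_mul_of_pos_right _ (Nat.pow_pos h2))

end Assembly

/-- For `n ≥ 2` there exist `C > 0` and `k ≥ 1` such that for every finite field `K` of
characteristic `≠ 2` and every generating set `A` of `SL_n(K)`, the number of conjugacy
classes of `SL_n(K)` meeting the set of semisimple elements of `A_k` is at least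
`C·|A|^(1/(n+1))`. -/
theorem statement_4 (n : ℕ) (hn : 2 ≤ n) :
    ∃ (C : ℝ) (k : ℕ), 0 < C ∧ 0 < k ∧
      ∀ (K : Type) [Field K] [Fintype K], ringChar K ≠ 2 →
        ∀ A : Set (Matrix.SpecialLinearGroup (Fin n) K),
          Subgroup.closure A = ⊤ →
          C * (A.ncard : ℝ) ^ ((1 : ℝ) / (n + 1)) ≤
            ((ConjClasses.mk '' {g ∈ prodSet A k | IsSemisimpleElt n K g}).ncard : ℝ) := by
  set N := escapeDegree n * relDegree n ^ (n * n) + fieldBound n ^ (n * n) with hN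
  have hNpos : (0 : ℝ) < N := by
    have : 0 < fieldBound n ^ (n * n) := Nat.pow_pos (Nat.succ_pos _)
    exact_mod_cast this.trans_le (Nat.le_add_left _ _)
  have hexp : (0 : ℝ) < (1 : ℝ) / (n + 1) := by positivity
  refine ⟨((N : ℝ) ^ ((1 : ℝ) / (n + 1)))⁻¹, classExponent n, by positivity, ?_, ?_⟩
  · rw [classExponent, add_assoc]
    exact Nat.add_pos_left one_pos _
  · intro K _ _ _ A hA
    rw [inv_mul_le_iff₀ (by positivity)]
    have h := ncard_le_mul_ncard_pow (by omega) hA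
    set c := (ConjClasses.mk '' {g ∈ prodSet A (classExponent n) | IsSemisimpleElt n K g}).ncard
    calc (A.ncard : ℝ) ^ ((1 : ℝ) / (n + 1))
        ≤ ((N : ℝ) * (c : ℝ) ^ (n + 1)) ^ ((1 : ℝ) / (n + 1)) :=
          Real.rpow_le_rpow (by positivity) (by exact_mod_cast h) hexp.le
      _ = (N : ℝ) ^ ((1 : ℝ) / (n + 1)) * c := by
          rw [Real.mul_rpow hNpos.le (by positivity), one_div]
          have := Real.pow_rpow_inv_natCast (Nat.cast_nonneg c) (Nat.succ_ne_zero n)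
          rw [Nat.cast_succ] at this
          rw [this]
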